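/- The set of locally eventually onto maps f ∈ CP such that λ(Per(f)) = 1 and λ(Per(f,k)) > 0 for every integer k ≥ 1 is dense in (CP, ρ). -/

import Mathlib

open Set Function Metric MeasureTheory

/-- The unit interval `[0,1]` with the Euclidean metric. -/
abbrev unitI : Type := Set.Icc (0:ℝ) 1

/-- `CP`: continuous surjective self-maps of `I` with a dense set of periodic points.
The ambient space `C(I,I)` carries the uniform (sup) metric. -/
def CP : Set C(unitI, unitI) :=
  {f | Function.Surjective ⇑f ∧ Dense (Function.periodicPts ⇑f)}

/-- `f` is locally eventually onto (leo, topologically exact): every nonempty open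
subset of `I` is mapped onto `I` by some iterate of `f`. -/
def Leo (f : unitI → unitI) : Prop :=
  ∀ U : Set unitI, IsOpen U → U.Nonempty → ∃ n : ℕ, f^[n] '' U = Set.univ

/-- `Per(f,k) = {x : f^k x = x and f^i x ≠ x for 1 ≤ i < k}`. -/
def PerSet (f : unitI → unitI) (k : ℕ) : Set unitI :=
  {x | f^[k] x = x ∧ ∀ i, 1 ≤ i → i < k → f^[i] x ≠ x}

/-- `Per(f) = ⋃_{k ≥ 1} Per(f,k)`. -/
def PerAll (f : unitI → unitI) : Set unitI := ⋃ k ∈ {k : ℕ | 1 ≤ k}, PerSet f k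

/-! ### The triangle wave and the reflection of the line onto `[0,1]` -/

/-- The distance to the nearest integer. -/
noncomputable def triangleWave (x : ℝ) : ℝ := |x - round x|

theorem triangleWave_eq_of_abs_le {x : ℝ} {m : ℤ} (h : |x - m| ≤ 1 / 2) :
    triangleWave x = |x - m| := by
  unfold triangleWave
  refine le_antisymm (round_le x m) ?_
  by_cases hm : round x = m
  · rw [hm]
  · have h1 : (1 : ℝ) ≤ |((round x - m : ℤ) : ℝ)| := by
      exact_mod_cast Int.one_le_abs (sub_ne_zero.mpr hm)
    push_cast at h1
    have h2 : |(round x : ℝ) - m| ≤ |x - round x| + |x - m| := by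
      rw [abs_sub_comm x (round x)]
      exact abs_sub_le _ _ _
    linarith

theorem triangleWave_nonneg (x : ℝ) : 0 ≤ triangleWave x := abs_nonneg _

theorem triangleWave_le_half (x : ℝ) : triangleWave x ≤ 1 / 2 := abs_sub_round x

theorem abs_triangleWave_sub_le (x y : ℝ) : |triangleWave x - triangleWave y| ≤ |x - y| := by
  have key : ∀ x y : ℝ, triangleWave x ≤ |x - y| + triangleWave y := fun x y =>
    (round_le x (round y)).trans (abs_sub_le _ _ _)
  have h1 := key x y
  have h2 := key y x
  rw [abs_sub_comm y x] at h2
  exact abs_sub_le_iff.mpr ⟨by linarith, by linarith⟩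

theorem continuous_of_abs_sub_le {F : ℝ → ℝ} (h : ∀ x y, |F x - F y| ≤ |x - y|) :
    Continuous F :=
  (LipschitzWith.of_dist_le_mul (K := 1) fun x y => by
    simpa [Real.dist_eq] using h x y).continuous

theorem continuous_triangleWave : Continuous triangleWave :=
  continuous_of_abs_sub_le abs_triangleWave_sub_le

theorem triangleWave_intCast (m : ℤ) : triangleWave m = 0 := by
  simp [triangleWave]

theorem triangleWave_intCast_add_half (m : ℤ) : triangleWave (m + 1 / 2) = 1 / 2 := by
  rw [triangleWave_eq_of_abs_le (m := m)] <;> norm_num [abs_of_pos]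

/-- From every point the triangle wave has unit slope on a stretch of length `1/4`, on one side. -/
theorem abs_triangleWave_add_sub_eq (c : ℝ) {h : ℝ} (h0 : 0 ≤ h) (h1 : h ≤ 1 / 4) :
    |triangleWave (c + h) - triangleWave c| = h ∨ |triangleWave (c - h) - triangleWave c| = h := by
  have hc := abs_le.mp (abs_sub_round c)
  have eq : ∀ x : ℝ, -(1 / 2) ≤ x - round c → x - round c ≤ 1 / 2 →
      triangleWave x = |x - round c| := fun x a b =>
    triangleWave_eq_of_abs_le (abs_le.mpr ⟨a, b⟩)
  rw [eq c hc.1 hc.2]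
  rcases le_total 0 (c - round c) with hs | hs
  · rcases le_total (c - round c) (1 / 4) with hq | hq
    · left
      rw [eq (c + h) (by linarith) (by linarith), abs_of_nonneg hs,
        abs_of_nonneg (by linarith : 0 ≤ c + h - round c)]
      ring_nf; exact abs_of_nonneg h0
    · right
      rw [eq (c - h) (by linarith) (by linarith), abs_of_nonneg hs,
        abs_of_nonneg (by linarith : 0 ≤ c - h - round c)]
      ring_nf; rw [abs_neg]; exact abs_of_nonneg h0
  · rcases le_total (-(1 / 4)) (c - round c) with hq | hq
    · right
      rw [eq (c - h) (by linarith) (by linarith), abs_of_nonpos hs,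
        abs_of_nonpos (by linarith : c - h - round c ≤ 0)]
      ring_nf; exact abs_of_nonneg h0
    · left
      rw [eq (c + h) (by linarith) (by linarith), abs_of_nonpos hs,
        abs_of_nonpos (by linarith : c + h - round c ≤ 0)]
      ring_nf; rw [abs_neg]; exact abs_of_nonneg h0

/-- The line folded onto `[0,1]` by reflections at the integers. -/
noncomputable def reflectUnit (y : ℝ) : ℝ := 2 * triangleWave (y / 2)

theorem reflectUnit_of_mem {y : ℝ} (h0 : 0 ≤ y) (h1 : y ≤ 1) : reflectUnit y = y := by
  have h : |y / 2 - (0 : ℤ)| ≤ 1 / 2 := by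
    rw [abs_le]; constructor <;> push_cast <;> linarith
  rw [reflectUnit, triangleWave_eq_of_abs_le h, abs_of_nonneg (by push_cast; linarith)]
  push_cast; ring

theorem reflectUnit_mem (y : ℝ) : reflectUnit y ∈ Icc (0 : ℝ) 1 := by
  have h1 := triangleWave_nonneg (y / 2)
  have h2 := triangleWave_le_half (y / 2)
  constructor <;> unfold reflectUnit <;> linarith

theorem abs_reflectUnit_sub_le (x y : ℝ) : |reflectUnit x - reflectUnit y| ≤ |x - y| := by
  have h := abs_triangleWave_sub_le (x / 2) (y / 2)
  have e : x / 2 - y / 2 = (x - y) / 2 := by ring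
  rw [e, abs_div, abs_two] at h
  rw [reflectUnit, reflectUnit, ← mul_sub, abs_mul, abs_two]
  linarith

theorem continuous_reflectUnit : Continuous reflectUnit :=
  continuous_of_abs_sub_le abs_reflectUnit_sub_le

theorem abs_reflectUnit_add_sub_eq (c : ℝ) {h : ℝ} (h0 : 0 ≤ h) (h1 : h ≤ 1 / 2) :
    |reflectUnit (c + h) - reflectUnit c| = h ∨ |reflectUnit (c - h) - reflectUnit c| = h := by
  simp only [reflectUnit, ← mul_sub, abs_mul, abs_two]
  refine (abs_triangleWave_add_sub_eq (c / 2) (h := h / 2) (by linarith) (by linarith)).imp ?_ ?_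
  · intro H
    rw [add_div, H]; ring
  · intro H
    rw [sub_div, H]; ring

theorem reflectUnit_ne_zero_and_ne_one {y : ℝ} (hy : ∀ m : ℤ, y ≠ m) :
    reflectUnit y ≠ 0 ∧ reflectUnit y ≠ 1 := by
  unfold reflectUnit triangleWave
  set m := round (y / 2)
  refine ⟨fun h => hy (2 * m) ?_, fun h => ?_⟩
  · have : y / 2 - m = 0 := abs_eq_zero.mp (by linarith)
    push_cast; linarith
  · have h' : |y / 2 - m| = 1 / 2 := by linarith
    rcases (abs_eq (by norm_num)).mp h' with h' | h'
    · exact hy (2 * m + 1) (by push_cast; linarith)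
    · exact hy (2 * m - 1) (by push_cast; linarith)

/-! ### Self-maps of the unit interval as functions on the line -/

/-- Extension of a self-map of `[0,1]` to the line, constant on each side of `[0,1]`. -/
noncomputable def lineExt (f : unitI → unitI) (x : ℝ) : ℝ := f (projIcc 0 1 zero_le_one x)

theorem lineExt_coe (f : unitI → unitI) (x : unitI) : lineExt f x = f x := by
  simp [lineExt]

theorem lineExt_mem (f : unitI → unitI) (x : ℝ) : lineExt f x ∈ Icc (0 : ℝ) 1 := Subtype.mem _

theorem continuous_lineExt {f : unitI → unitI} (hf : Continuous f) : Continuous (lineExt f) :=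
  continuous_subtype_val.comp (hf.comp continuous_projIcc)

theorem lineExt_iterate_coe (f : unitI → unitI) (n : ℕ) (x : unitI) :
    (lineExt f)^[n] x = (f^[n] x : unitI) :=
  (Function.Semiconj.iterate_right (f := ((↑) : unitI → ℝ)) (ga := f) (gb := lineExt f)
    (fun x => (lineExt_coe f x).symm) n x).symm

theorem continuous_lineExt_iterate {f : unitI → unitI} (hf : Continuous f) (n : ℕ) :
    Continuous (lineExt f)^[n] := (continuous_lineExt hf).iterate n

theorem exists_Icc_near {z η : ℝ} (hz : z ∈ Icc (0 : ℝ) 1) (hη : 0 < η) :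
    ∃ s t : ℝ, 0 < s ∧ s < t ∧ t < 1 ∧ z - η < s ∧ t < z + η := by
  obtain ⟨h0, h1⟩ := hz
  have h : max 0 (z - η) < min 1 (z + η) := by
    simp only [max_lt_iff, lt_min_iff]
    refine ⟨⟨?_, ?_⟩, ?_, ?_⟩ <;> linarith
  obtain ⟨s, hs1, hs2⟩ := exists_between h
  obtain ⟨t, ht1, ht2⟩ := exists_between hs2
  exact ⟨s, t, (le_max_left _ _).trans_lt hs1, ht1, ht2.trans_le (min_le_left _ _),
    (le_max_right _ _).trans_lt hs1, ht2.trans_le (min_le_right _ _)⟩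

theorem exists_Icc_subset_of_isOpen {U : Set unitI} (hU : IsOpen U) (hne : U.Nonempty) :
    ∃ s t : ℝ, 0 < s ∧ s < t ∧ t < 1 ∧ ∀ x : unitI, s ≤ x → (x : ℝ) ≤ t → x ∈ U := by
  obtain ⟨z, hz⟩ := hne
  obtain ⟨ε, hε, hb⟩ := Metric.isOpen_iff.mp hU z hz
  obtain ⟨s, t, h0, hst, h1, hs, ht⟩ := exists_Icc_near z.2 hε
  refine ⟨s, t, h0, hst, h1, fun x hx1 hx2 => hb ?_⟩
  rw [Metric.mem_ball, Subtype.dist_eq, Real.dist_eq, abs_lt]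
  constructor <;> linarith

theorem exists_fixed_of_cross {φ : ℝ → ℝ} (hφ : Continuous φ) {u v : ℝ} (hu : φ u ≤ u)
    (hv : v ≤ φ v) : ∃ w ∈ uIcc u v, φ w = w := by
  have h := intermediate_value_uIcc (f := fun x => φ x - x) (a := u) (b := v)
    (hφ.sub continuous_id).continuousOn
  have h0 : (0 : ℝ) ∈ uIcc (φ u - u) (φ v - v) :=
    mem_uIcc.mpr (Or.inl ⟨by linarith, by linarith⟩)
  obtain ⟨w, hw, hw0⟩ := h h0
  exact ⟨w, hw, by linarith [show φ w - w = 0 from hw0]⟩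

theorem leo_of_lineExt {g : unitI → unitI}
    (h : ∀ s t : ℝ, 0 < s → s < t → t < 1 → ∃ n, Icc (0 : ℝ) 1 ⊆ (lineExt g)^[n] '' Icc s t) :
    Leo g := by
  intro U hU hne
  obtain ⟨s, t, h0, hst, h1, hsub⟩ := exists_Icc_subset_of_isOpen hU hne
  obtain ⟨n, hn⟩ := h s t h0 hst h1
  refine ⟨n, eq_univ_of_forall fun y => ?_⟩
  obtain ⟨x, hx, hxy⟩ := hn y.2
  refine ⟨⟨x, by linarith [hx.1], by linarith [hx.2]⟩, hsub _ hx.1 hx.2, ?_⟩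
  apply Subtype.ext
  rw [← lineExt_iterate_coe]
  exact hxy

theorem Leo.mem_CP {g : C(unitI, unitI)} (hg : Leo g) : g ∈ CP := by
  constructor
  · obtain ⟨n, hn⟩ := hg {x | (x : ℝ) < 1 / 2}
      (isOpen_lt continuous_subtype_val continuous_const) ⟨0, by simp⟩
    cases n with
    | zero =>
      exfalso
      have : (1 : unitI) ∈ (⇑g)^[0] '' {x | (x : ℝ) < 1 / 2} := hn ▸ mem_univ _
      simp at this
      norm_num at this
    | succ n =>
      intro y
      obtain ⟨x, -, hx⟩ : y ∈ (⇑g)^[n + 1] '' {x | (x : ℝ) < 1 / 2} := hn ▸ mem_univ _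
      rw [iterate_succ_apply'] at hx
      exact ⟨_, hx⟩
  · rw [dense_iff_inter_open]
    intro U hU hne
    obtain ⟨s, t, h0, hst, h1, hsub⟩ := exists_Icc_subset_of_isOpen hU hne
    obtain ⟨n, hn⟩ := hg {x | s < (x : ℝ) ∧ (x : ℝ) < t}
      ((isOpen_lt continuous_const continuous_subtype_val).inter
        (isOpen_lt continuous_subtype_val continuous_const))
      ⟨⟨(s + t) / 2, by constructor <;> linarith⟩, by constructor <;> simp <;> linarith⟩
    obtain ⟨u, hu, hu'⟩ : (0 : unitI) ∈ (⇑g)^[n] '' {x | s < (x : ℝ) ∧ (x : ℝ) < t} :=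
      hn ▸ mem_univ _
    obtain ⟨v, hv, hv'⟩ : (1 : unitI) ∈ (⇑g)^[n] '' {x | s < (x : ℝ) ∧ (x : ℝ) < t} :=
      hn ▸ mem_univ _
    have hu0 : (lineExt g)^[n] u = 0 := by rw [lineExt_iterate_coe, hu']; rfl
    have hv0 : (lineExt g)^[n] v = 1 := by rw [lineExt_iterate_coe, hv']; rfl
    obtain ⟨w, hw, hwf⟩ := exists_fixed_of_cross (continuous_lineExt_iterate g.continuous n)
      (hu0.trans_le u.2.1) (v.2.2.trans_eq hv0.symm)
    have hw1 : w ∈ Ioo s t := ordConnected_Ioo.uIcc_subset hu hv hw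
    have hwI : w ∈ Icc (0 : ℝ) 1 := ⟨by linarith [hw1.1], by linarith [hw1.2]⟩
    refine ⟨⟨w, hwI⟩, hsub _ hw1.1.le hw1.2.le, ?_⟩
    have hn0 : 0 < n := by
      rcases Nat.eq_zero_or_pos n with rfl | h
      · simp only [iterate_zero, id] at hu0
        have := hu.1
        linarith
      · exact h
    refine mk_mem_periodicPts hn0 (Subtype.ext ?_)
    rw [← lineExt_iterate_coe]
    exact hwf

/-! ### Coarse coverings and locally eventually onto maps -/

/-- `G` maps every subinterval of `[0,1]` of length at least `l` onto the part in `[0,1]` of the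
`r`-neighbourhood of the `F`-image of this subinterval. -/
def CoversNear (F G : ℝ → ℝ) (l r : ℝ) : Prop :=
  ∀ ⦃s t x y : ℝ⦄, 0 ≤ s → t ≤ 1 → l ≤ t - s → x ∈ Icc s t → y ∈ Icc (0 : ℝ) 1 →
    |y - F x| ≤ r → y ∈ G '' Icc s t

theorem CoversNear.closedBall_subset_succ {F G : ℝ → ℝ} {l r ρ : ℝ} (h : CoversNear F G l r)
    (hl : l ≤ ρ) (hρ0 : 0 ≤ ρ) (hρ : ρ ≤ 1) {S : Set ℝ} {n : ℕ} {z x : ℝ} (hz : z ∈ Icc (0 : ℝ) 1)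
    (hS : closedBall z ρ ∩ Icc 0 1 ⊆ G^[n] '' S) (hx : x ∈ closedBall z ρ ∩ Icc 0 1) :
    closedBall (F x) r ∩ Icc 0 1 ⊆ G^[n + 1] '' S := by
  rintro y ⟨hy, hyI⟩
  rw [iterate_succ', image_comp]
  obtain ⟨hxb, hxI⟩ := hx
  rw [Real.closedBall_eq_Icc] at hxb
  have hlen : l ≤ min 1 (z + ρ) - max 0 (z - ρ) := by
    rcases min_cases 1 (z + ρ) with ⟨h1, _⟩ | ⟨h1, _⟩ <;>
    rcases max_cases 0 (z - ρ) with ⟨h2, _⟩ | ⟨h2, _⟩ <;> rw [h1, h2] <;>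
    linarith [hz.1, hz.2]
  refine image_mono ?_ (h (le_max_left 0 (z - ρ)) (min_le_left 1 (z + ρ)) hlen
    ⟨max_le hxI.1 hxb.1, le_min hxI.2 hxb.2⟩ hyI (by rwa [← Real.dist_eq]))
  intro w hw
  refine hS ⟨?_, ?_⟩
  · rw [Real.closedBall_eq_Icc]
    exact ⟨(le_max_right _ _).trans hw.1, hw.2.trans (min_le_right _ _)⟩
  · exact ⟨(le_max_left _ _).trans hw.1, hw.2.trans (min_le_left _ _)⟩

theorem CoversNear.closedBall_iterate_subset {F G : ℝ → ℝ} {l r : ℝ} (h : CoversNear F G l r)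
    (hF : ∀ x, F x ∈ Icc (0 : ℝ) 1) (hl : l ≤ r) (hr0 : 0 ≤ r) (hr : r ≤ 1) {S : Set ℝ} {n : ℕ}
    {z : ℝ} (hz : z ∈ Icc (0 : ℝ) 1) (hS : closedBall z r ∩ Icc 0 1 ⊆ G^[n] '' S) (k : ℕ) :
    closedBall (F^[k] z) r ∩ Icc 0 1 ⊆ G^[n + k] '' S := by
  induction k with
  | zero => exact hS
  | succ k ih =>
    have hI : F^[k] z ∈ Icc (0 : ℝ) 1 := by
      cases k with
      | zero => exact hz
      | succ k => rw [iterate_succ_apply']; exact hF _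
    rw [iterate_succ_apply']
    exact h.closedBall_subset_succ hl hr0 hr hI ih ⟨mem_closedBall_self hr0, hI⟩

/-- If the image of `S` under an iterate of `G` contains one relative ball of radius `r`, then the
relative balls of radius `r` contained in such images cover `[0,1]`. -/
theorem CoversNear.exists_closedBall_subset {f : C(unitI, unitI)} (hf : f ∈ CP) {G : ℝ → ℝ}
    {l r : ℝ} (h : CoversNear (lineExt f) G l r) (hl : l ≤ r) (hr0 : 0 < r) (hr : r ≤ 1)
    {S : Set ℝ} {z₀ : unitI} {n₀ : ℕ} (hS : closedBall (z₀ : ℝ) r ∩ Icc 0 1 ⊆ G^[n₀] '' S)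
    (y : unitI) :
    ∃ (z : unitI) (n : ℕ), dist y z < r ∧ closedBall (z : ℝ) r ∩ Icc 0 1 ⊆ G^[n] '' S := by
  set Y : Set unitI :=
    {y | ∃ (z : unitI) (n : ℕ), dist y z < r ∧ closedBall (z : ℝ) r ∩ Icc 0 1 ⊆ G^[n] '' S}
  have step : ∀ y ∈ Y, ball y (r / 2) ⊆ Y := by
    rintro y ⟨z, n, hyz, hsub⟩ y' hy'
    obtain ⟨w, ⟨hw1, hw2⟩, hwp⟩ := hf.2.inter_open_nonempty (ball z r ∩ ball y (r / 2))
      (isOpen_ball.inter isOpen_ball) ⟨y, hyz, mem_ball_self (half_pos hr0)⟩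
    obtain ⟨k, hk, hwk⟩ := hwp
    obtain ⟨k, rfl⟩ := Nat.exists_eq_succ_of_ne_zero hk.ne'
    have hwz : (w : ℝ) ∈ closedBall (z : ℝ) r ∩ Icc 0 1 := ⟨(mem_ball.mp hw1).le, w.2⟩
    have h1 := h.closedBall_subset_succ hl hr0.le hr z.2 hsub hwz
    have h2 := h.closedBall_iterate_subset (lineExt_mem f) hl hr0.le hr (lineExt_mem f w) h1 k
    rw [← iterate_succ_apply, lineExt_iterate_coe, hwk] at h2
    refine ⟨w, _, ?_, h2⟩
    calc dist y' w ≤ dist y' y + dist w y := dist_triangle_right _ _ _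
      _ < r / 2 + r / 2 := add_lt_add hy' hw2
      _ = r := by ring
  have hclopen : IsClopen Y := by
    refine ⟨isClosed_of_closure_subset fun y hy => ?_, Metric.isOpen_iff.mpr fun y hy =>
      ⟨r / 2, half_pos hr0, step y hy⟩⟩
    obtain ⟨y', hy', hd⟩ := Metric.mem_closure_iff.mp hy (r / 2) (half_pos hr0)
    exact step y' hy' hd
  have huniv := hclopen.eq_univ ⟨z₀, z₀, n₀, by simpa using hr0, hS⟩
  exact (huniv ▸ mem_univ y : y ∈ Y)

theorem CoversNear.exists_iterate_image_Icc {f : C(unitI, unitI)} (hf : f ∈ CP) {G : ℝ → ℝ}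
    {l r : ℝ} (h : CoversNear (lineExt f) G l r) (hl : l ≤ r) (hr0 : 0 < r) (hr : r ≤ 1)
    {s t : ℝ} (hs : 0 ≤ s) (hst : s ≤ t) (ht : t ≤ 1) (hlen : l ≤ t - s) :
    ∃ n, Icc (0 : ℝ) 1 ⊆ G^[n] '' Icc s t := by
  obtain ⟨x₀, hx₀I, hx₀⟩ := exists_mem_Icc_isFixedPt_of_mapsTo
    (continuous_lineExt f.continuous).continuousOn zero_le_one
    (fun x _ => lineExt_mem f x)
  set J := closedBall x₀ r ∩ Icc (0 : ℝ) 1 with hJ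
  have hJ0 : J ⊆ G^[0] '' J := by simp
  have hJ1 : J ⊆ G '' J := by
    have := h.closedBall_subset_succ hl hr0.le hr hx₀I hJ0 ⟨mem_closedBall_self hr0.le, hx₀I⟩
    rwa [hx₀] at this
  have hmono : Monotone fun n => G^[n] '' J := monotone_nat_of_le_succ fun n => by
    rw [iterate_succ, image_comp]
    exact image_mono hJ1
  obtain ⟨N, hN⟩ := isCompact_univ.elim_directed_cover
    (fun n => interior (((↑) : unitI → ℝ) ⁻¹' (G^[n] '' J))) (fun _ => isOpen_interior)
    (fun y _ => by
      obtain ⟨z, n, hyz, hsub⟩ :=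
        h.exists_closedBall_subset hf hl hr0 hr (z₀ := ⟨x₀, hx₀I⟩) hJ0 y
      exact mem_iUnion.mpr ⟨n, mem_interior.mpr ⟨ball z r,
        fun w hw => hsub ⟨(mem_ball.mp hw).le, w.2⟩, isOpen_ball, hyz⟩⟩)
    (Monotone.directed_le fun _ _ hab => interior_mono (preimage_mono (hmono hab)))
  have h1 : closedBall (lineExt f s) r ∩ Icc 0 1 ⊆ G^[1] '' Icc s t := fun y hy =>
    h hs ht hlen (left_mem_Icc.mpr hst) hy.2 (by rw [← Real.dist_eq]; exact hy.1)
  obtain ⟨z, n, hz, hsub⟩ := h.exists_closedBall_subset hf hl hr0 hr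
    (z₀ := ⟨_, lineExt_mem f s⟩) h1 ⟨x₀, hx₀I⟩
  have h2 := h.closedBall_subset_succ hl hr0.le hr z.2 hsub ⟨hz.le, hx₀I⟩
  rw [hx₀] at h2
  refine ⟨N + (n + 1), fun y hy => ?_⟩
  rw [iterate_add, image_comp]
  have hyN : (⟨y, hy⟩ : unitI) ∈ ((↑) : unitI → ℝ) ⁻¹' (G^[N] '' J) :=
    interior_subset (hN (mem_univ _))
  exact image_mono h2 hyN

/-- Short intervals grow under iteration until they have length at least `l`. -/
theorem exists_iterate_image_length {G : ℝ → ℝ} (hG : Continuous G)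
    (hGI : ∀ x, G x ∈ Icc (0 : ℝ) 1) {l : ℝ}
    (hexp : ∀ s t : ℝ, 0 ≤ s → s < t → t ≤ 1 → t - s ≤ l →
      ∃ u ∈ Icc s t, ∃ v ∈ Icc s t, min (2 * (t - s)) l ≤ |G u - G v|)
    {s t : ℝ} (hs : 0 ≤ s) (hst : s < t) (ht : t ≤ 1) :
    ∃ (n : ℕ) (a b : ℝ), 0 ≤ a ∧ b ≤ 1 ∧ l ≤ b - a ∧ Icc a b ⊆ G^[n] '' Icc s t := by
  by_contra! hno
  have grow : ∀ n : ℕ, ∃ a b : ℝ, 0 ≤ a ∧ b ≤ 1 ∧ 2 ^ n * (t - s) ≤ b - a ∧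
      Icc a b ⊆ G^[n] '' Icc s t := by
    intro n
    induction n with
    | zero => exact ⟨s, t, hs, ht, by simp, by simp⟩
    | succ n ih =>
      obtain ⟨a, b, ha, hb, hab, hsub⟩ := ih
      have hab0 : 0 < b - a := lt_of_lt_of_le (by have := sub_pos.mpr hst; positivity) hab
      have hlt : b - a < l := lt_of_not_ge fun hle => hno n a b ha hb hle hsub
      obtain ⟨u, hu, v, hv, huv⟩ := hexp a b ha (by linarith) hb hlt.le
      have hsub' : uIcc (G u) (G v) ⊆ G^[n + 1] '' Icc s t := by
        rw [iterate_succ', image_comp]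
        exact (intermediate_value_uIcc hG.continuousOn).trans
          (image_mono ((ordConnected_Icc.uIcc_subset hu hv).trans hsub))
      have hlen : max (G u) (G v) - min (G u) (G v) = |G u - G v| := max_sub_min_eq_abs' _ _
      have h0 : 0 ≤ min (G u) (G v) := le_min (hGI u).1 (hGI v).1
      have h1 : max (G u) (G v) ≤ 1 := max_le (hGI u).2 (hGI v).2
      refine ⟨_, _, h0, h1, ?_, hsub'⟩
      rw [hlen]
      rcases min_le_iff.mp huv with hc | hc
      · rw [pow_succ]; linarith
      · exact absurd hsub' (hno (n + 1) _ _ h0 h1 (hlen ▸ hc))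
  obtain ⟨n, hn⟩ := pow_unbounded_of_one_lt (1 / (t - s)) (one_lt_two (α := ℝ))
  obtain ⟨a, b, ha, hb, hab, -⟩ := grow n
  rw [div_lt_iff₀ (sub_pos.mpr hst)] at hn
  linarith

/-! ### Oscillating perturbations -/

/-- The function `p` with a triangle wave of amplitude `A / 2` and frequency `M` added, folded back
onto `[0,1]`. -/
noncomputable def zigzag (p : ℝ → ℝ) (A M : ℝ) (x : ℝ) : ℝ :=
  reflectUnit (p x + A * triangleWave (M * x))

theorem continuous_zigzag {p : ℝ → ℝ} (hp : Continuous p) (A M : ℝ) :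
    Continuous (zigzag p A M) := by
  have := continuous_triangleWave
  exact continuous_reflectUnit.comp (by fun_prop)

theorem zigzag_expanding {p : ℝ → ℝ} (hp : Continuous p) {A M L : ℝ} (hA : 0 < A) (hM : 4 ≤ M)
    (hL : ∀ x ∈ Icc (0 : ℝ) 1, ∀ y ∈ Icc (0 : ℝ) 1, |p x - p y| ≤ L * |x - y|)
    (hAM : 32 ≤ A * M - L) {s t : ℝ} (hs : 0 ≤ s) (hst : s < t) (ht : t ≤ 1)
    (hlen : t - s ≤ 2 / M) :
    ∃ u ∈ Icc s t, ∃ v ∈ Icc s t,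
      min (2 * (t - s)) (2 / M) ≤ |zigzag p A M u - zigzag p A M v| := by
  have hM0 : 0 < M := by linarith
  set H : ℝ → ℝ := fun x => p x + A * triangleWave (M * x) with hHdef
  have hH : Continuous H := by
    have := continuous_triangleWave
    fun_prop
  set d := t - s with hd
  have hd0 : 0 < d := sub_pos.mpr hst
  have hdM : M * d ≤ 2 := by rwa [le_div_iff₀ hM0, mul_comm] at hlen
  set c := (s + t) / 2 with hc
  have hcI : c ∈ Icc s t := ⟨by linarith, by linarith⟩
  obtain ⟨x, hxI, hxd, hxT⟩ : ∃ x ∈ Icc s t, |x - c| = d / 8 ∧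
      |triangleWave (M * x) - triangleWave (M * c)| = M * (d / 8) := by
    rcases abs_triangleWave_add_sub_eq (M * c) (h := M * (d / 8)) (by positivity) (by linarith)
      with h | h
    · refine ⟨c + d / 8, ⟨by linarith, by linarith⟩, ?_, by rw [mul_add]; exact h⟩
      rw [add_sub_cancel_left]; exact abs_of_pos (by linarith)
    · refine ⟨c - d / 8, ⟨by linarith, by linarith⟩, ?_, by rw [mul_sub]; exact h⟩
      rw [sub_sub_cancel_left, abs_neg]; exact abs_of_pos (by linarith)
  have hI : ∀ {y}, y ∈ Icc s t → y ∈ Icc (0 : ℝ) 1 := fun hy => ⟨hs.trans hy.1, hy.2.trans ht⟩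
  have hHd : 4 * d ≤ |H x - H c| := by
    have e : H x - H c = A * (triangleWave (M * x) - triangleWave (M * c)) - (p c - p x) := by
      simp only [hHdef]; ring
    have h1 := hL c (hI hcI) x (hI hxI)
    rw [abs_sub_comm c x, hxd] at h1
    have h2 := abs_sub_abs_le_abs_sub (A * (triangleWave (M * x) - triangleWave (M * c)))
      (p c - p x)
    rw [← e, abs_mul, abs_of_pos hA, hxT] at h2
    nlinarith
  set e := min (2 * d) (1 / 2) with he
  have he0 : 0 ≤ e := le_min (by linarith) (by norm_num)
  have he1 : e ≤ 2 * d := min_le_left _ _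
  set m := (H x + H c) / 2 with hm
  have hIVT : ∀ y, |y - m| ≤ e → ∃ u ∈ Icc s t, H u = y := by
    intro y hy
    have hmem : y ∈ uIcc (H x) (H c) := by
      rw [abs_le] at hy
      rcases le_total (H x) (H c) with h | h
      · rw [abs_of_nonpos (by linarith)] at hHd
        exact mem_uIcc.mpr (Or.inl ⟨by linarith, by linarith⟩)
      · rw [abs_of_nonneg (by linarith)] at hHd
        exact mem_uIcc.mpr (Or.inr ⟨by linarith, by linarith⟩)
    obtain ⟨u, hu, huy⟩ := intermediate_value_uIcc hH.continuousOn hmem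
    exact ⟨u, ordConnected_Icc.uIcc_subset hxI hcI hu, huy⟩
  obtain ⟨v, hv, hvm⟩ := hIVT m (by simpa using he0)
  have hmin : min (2 * d) (2 / M) ≤ e :=
    min_le_min_left _ (by rw [div_le_div_iff₀ hM0 two_pos]; linarith)
  rcases abs_reflectUnit_add_sub_eq m he0 (min_le_right _ _) with h | h
  · obtain ⟨u, hu, hum⟩ := hIVT (m + e) (by simp [abs_of_nonneg he0])
    refine ⟨u, hu, v, hv, hmin.trans (le_of_eq ?_)⟩
    rw [← h, ← hum, ← hvm]; rfl
  · obtain ⟨u, hu, hum⟩ := hIVT (m - e) (by simp [abs_of_nonneg he0])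
    refine ⟨u, hu, v, hv, hmin.trans (le_of_eq ?_)⟩
    rw [← h, ← hum, ← hvm]; rfl

theorem zigzag_coversNear {F p : ℝ → ℝ} (hp : Continuous p) {A M L : ℝ} (hM : 0 < M)
    (hL : ∀ x ∈ Icc (0 : ℝ) 1, ∀ y ∈ Icc (0 : ℝ) 1, |p x - p y| ≤ L * |x - y|) (hL0 : 0 ≤ L)
    (hLM : L * (2 / M) ≤ A / 32)
    (hpF : ∀ x ∈ Icc (0 : ℝ) 1, |p x - (F x - A / 4)| ≤ A / 32) :
    CoversNear F (zigzag p A M) (2 / M) (A / 8) := by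
  intro s t x y hs ht hlen hx hy hyx
  have hM2 : 0 < 2 / M := by positivity
  set s' := min x (t - 2 / M) with hs'
  have h1 : s ≤ s' := le_min hx.1 (by linarith)
  have h2 : s' ≤ x := min_le_left _ _
  have h3 : s' + 2 / M ≤ t := by linarith [min_le_right x (t - 2 / M)]
  have h4 : x ≤ s' + 2 / M := by
    rw [hs', ← min_add_add_right]; exact le_min (by linarith) (by linarith [hx.2])
  set m : ℤ := ⌈M * s'⌉ with hm
  have hm1 : M * s' ≤ m := Int.le_ceil _
  have hm2 : (m : ℝ) < M * s' + 1 := Int.ceil_lt_add_one _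
  have near : ∀ k : ℝ, M * s' ≤ k → k ≤ M * s' + 2 →
      k / M ∈ Icc s t ∧ p (k / M) ∈ Icc (F x - A / 4 - A / 16) (F x - A / 4 + A / 16) := by
    intro k hk1 hk2
    have hk3 : s' ≤ k / M := by rw [le_div_iff₀ hM]; linarith
    have hk4 : k / M ≤ s' + 2 / M := by
      rw [div_le_iff₀ hM, add_mul, div_mul_cancel₀ _ hM.ne']; linarith
    have hk5 : k / M ∈ Icc s t := ⟨by linarith, by linarith⟩
    have hp1 := hL (k / M) ⟨by linarith, by linarith⟩ x ⟨by linarith [hx.1], by linarith [hx.2]⟩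
    have hp2 : |k / M - x| ≤ 2 / M := abs_le.mpr ⟨by linarith, by linarith⟩
    have hp3 := abs_le.mp ((hp1.trans (mul_le_mul_of_nonneg_left hp2 hL0)).trans hLM)
    have hp4 := abs_le.mp (hpF x ⟨by linarith [hx.1], by linarith [hx.2]⟩)
    exact ⟨hk5, by linarith, by linarith⟩
  obtain ⟨ha, hpa⟩ := near m hm1 (by linarith)
  obtain ⟨hb, hpb⟩ := near (m + 1 / 2) (by linarith) (by linarith)
  set H : ℝ → ℝ := fun x => p x + A * triangleWave (M * x) with hHdef
  have hH : Continuous H := by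
    have := continuous_triangleWave
    fun_prop
  have hHa : H (m / M) = p (m / M) := by
    simp only [hHdef, mul_div_cancel₀ _ hM.ne', triangleWave_intCast]; ring
  have hHb : H ((m + 1 / 2) / M) = p ((m + 1 / 2) / M) + A / 2 := by
    simp only [hHdef, mul_div_cancel₀ _ hM.ne', triangleWave_intCast_add_half]; ring
  rw [abs_le] at hyx
  have hmem : y ∈ uIcc (H (m / M)) (H ((m + 1 / 2) / M)) := by
    rw [hHa, hHb]
    exact mem_uIcc.mpr (Or.inl ⟨by linarith [hpa.2], by linarith [hpb.1]⟩)
  obtain ⟨w, hw, hwy⟩ := intermediate_value_uIcc hH.continuousOn hmem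
  refine ⟨w, ordConnected_Icc.uIcc_subset ha hb hw, ?_⟩
  change reflectUnit (H w) = y
  rw [hwy, reflectUnit_of_mem hy.1 hy.2]

theorem CoversNear.mono {F G : ℝ → ℝ} {l l' r r' : ℝ} (h : CoversNear F G l r) (hl : l ≤ l')
    (hr : r' ≤ r) : CoversNear F G l' r' := fun _ _ _ _ hs ht hlen hx hy hyx =>
  h hs ht (hl.trans hlen) hx hy (hyx.trans hr)

/-- Every map in `CP` is approximated by a locally eventually onto map which oscillates by a fixed
amount on all intervals of a prescribed small length. -/
theorem exists_leo_coversNear {f : C(unitI, unitI)} (hf : f ∈ CP) {A : ℝ} (hA : 0 < A)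
    (hA1 : A ≤ 1) {l : ℝ} (hl : 0 < l) :
    ∃ g : C(unitI, unitI), Leo g ∧ dist f g ≤ A ∧ ((g 0 ≠ 0 ∧ g 0 ≠ 1) ∧ g 1 ≠ 0 ∧ g 1 ≠ 1) ∧
      CoversNear (lineExt f) (lineExt g) l (A / 8) := by
  obtain ⟨q, hq⟩ := exists_polynomial_near_of_continuousOn 0 1 (lineExt f)
    (continuous_lineExt f.continuous).continuousOn (A / 64) (by positivity)
  obtain ⟨c, hcA, hc⟩ : ∃ c ∈ ball (A / 4) (A / 64),
      c ∈ (range (fun m : ℤ => q.eval 0 - m) ∪ range (fun m : ℤ => q.eval 1 - m))ᶜ :=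
    (((countable_range _).union (countable_range _)).dense_compl ℝ).inter_open_nonempty _
      isOpen_ball ⟨_, mem_ball_self (by positivity)⟩
  rw [mem_ball, Real.dist_eq] at hcA
  simp only [mem_compl_iff, mem_union, mem_range, not_or, not_exists] at hc
  set p : ℝ → ℝ := fun x => q.eval x - c with hp
  have hpc : Continuous p := q.continuous.sub continuous_const
  have hpf : ∀ x ∈ Icc (0 : ℝ) 1, |p x - (lineExt f x - A / 4)| ≤ A / 32 := by
    intro x hx
    have h1 := hq x hx
    rw [abs_lt] at h1 hcA
    rw [abs_le]
    constructor <;> simp only [hp] <;> linarith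
  have hqC : ContDiff ℝ 1 (fun x : ℝ => q.eval x) := by
    simpa using q.contDiff_aeval (𝕜 := ℝ) (n := 1)
  obtain ⟨K, hK⟩ := hqC.contDiffOn.exists_lipschitzOnWith one_ne_zero
    (convex_Icc (0 : ℝ) 1) isCompact_Icc
  have hL : ∀ x ∈ Icc (0 : ℝ) 1, ∀ y ∈ Icc (0 : ℝ) 1, |p x - p y| ≤ K * |x - y| := by
    intro x hx y hy
    have := hK.dist_le_mul x hx y hy
    simpa [hp, Real.dist_eq] using this
  have hK0 : (0 : ℝ) ≤ K := K.2
  obtain ⟨M, hM⟩ := exists_nat_ge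
    (4 + 2 / l + 64 * K / A + (32 + K) / A + 16 / A)
  have hl1 : 0 < 2 / l := by positivity
  have hl2 : 0 ≤ 64 * K / A := by positivity
  have hl3 : 0 ≤ (32 + K) / A := by positivity
  have hl4 : 0 < 16 / A := by positivity
  have hM4 : (4 : ℝ) ≤ M := by linarith
  have hM0 : (0 : ℝ) < M := by linarith
  have hMl : 2 / (M : ℝ) ≤ l := by
    rw [div_le_comm₀ hM0 hl]; linarith
  have hMr : 2 / (M : ℝ) ≤ A / 8 := by
    have h : 16 / A ≤ M := by linarith
    rw [div_le_iff₀ hA] at h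
    rw [div_le_iff₀ hM0]; linarith
  have hMK : (K : ℝ) * (2 / M) ≤ A / 32 := by
    have h : 64 * K / A ≤ M := by linarith
    rw [div_le_iff₀ hA] at h
    rw [← mul_div_assoc, div_le_iff₀ hM0]; linarith
  have hAM : 32 ≤ A * M - K := by
    have h : (32 + K) / A ≤ M := by linarith
    rw [div_le_iff₀ hA] at h
    linarith
  set Z := zigzag p A M with hZ
  have hZc : Continuous Z := continuous_zigzag hpc A M
  let g : C(unitI, unitI) :=
    ⟨fun x => ⟨Z x, reflectUnit_mem _⟩, (hZc.comp continuous_subtype_val).subtype_mk _⟩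
  have hgZ : ∀ x ∈ Icc (0 : ℝ) 1, lineExt g x = Z x := fun x hx => lineExt_coe g ⟨x, hx⟩
  have hcov : CoversNear (lineExt f) (lineExt g) (2 / M) (A / 8) := by
    intro s t x y hs ht hlen hx hy hyx
    obtain ⟨w, hw, hwy⟩ := zigzag_coversNear hpc hM0 hL hK0 hMK hpf hs ht hlen hx hy hyx
    exact ⟨w, hw, (hgZ w ⟨hs.trans hw.1, hw.2.trans ht⟩).trans hwy⟩
  refine ⟨g, leo_of_lineExt fun s t hs hst ht => ?_, ?_, ?_, hcov.mono hMl le_rfl⟩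
  · obtain ⟨n, a, b, ha, hb, hab, hsub⟩ := exists_iterate_image_length (l := 2 / M)
      (continuous_lineExt g.continuous) (lineExt_mem g) (fun s t hs hst ht hlen => by
        obtain ⟨u, hu, v, hv, huv⟩ := zigzag_expanding hpc hA hM4 hL hAM hs hst ht hlen
        refine ⟨u, hu, v, hv, ?_⟩
        rwa [hgZ u ⟨hs.trans hu.1, hu.2.trans ht⟩, hgZ v ⟨hs.trans hv.1, hv.2.trans ht⟩])
      hs.le hst ht.le
    have hab' : a ≤ b := by
      have : 0 < 2 / (M : ℝ) := by positivity
      linarith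
    obtain ⟨N, hN⟩ := hcov.exists_iterate_image_Icc hf hMr (by positivity) (by linarith)
      ha hab' hb hab
    refine ⟨N + n, hN.trans ?_⟩
    rw [iterate_add, image_comp]
    exact image_mono hsub
  · refine (ContinuousMap.dist_le hA.le).mpr fun x => ?_
    rw [Subtype.dist_eq, Real.dist_eq, abs_sub_comm]
    change |reflectUnit (p x + A * triangleWave (M * x)) - f x| ≤ A
    rw [← reflectUnit_of_mem (f x).2.1 (f x).2.2]
    refine (abs_reflectUnit_sub_le _ _).trans ?_
    have h1 := hpf x x.2
    rw [lineExt_coe, abs_le] at h1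
    have h2 := mul_nonneg hA.le (triangleWave_nonneg (M * x))
    have h3 := mul_le_mul_of_nonneg_left (triangleWave_le_half (M * x)) hA.le
    rw [abs_le]
    constructor <;> linarith
  · have hg0 : ((g 0 : unitI) : ℝ) = reflectUnit (p 0) := by
      change reflectUnit (p 0 + A * triangleWave (M * 0)) = _
      have := triangleWave_intCast 0
      rw [Int.cast_zero] at this
      rw [mul_zero, this, mul_zero, add_zero]
    have hg1 : ((g 1 : unitI) : ℝ) = reflectUnit (p 1) := by
      change reflectUnit (p 1 + A * triangleWave (M * 1)) = _
      have := triangleWave_intCast M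
      rw [Int.cast_natCast] at this
      rw [mul_one, this, mul_zero, add_zero]
    have h0 := reflectUnit_ne_zero_and_ne_one (y := p 0) fun m hm => hc.1 m (by
      simp only [hp] at hm; linarith)
    have h1 := reflectUnit_ne_zero_and_ne_one (y := p 1) fun m hm => hc.2 m (by
      simp only [hp] at hm; linarith)
    rw [← hg0] at h0
    rw [← hg1] at h1
    exact ⟨⟨fun h => h0.1 (by rw [h]; rfl), fun h => h0.2 (by rw [h]; rfl)⟩,
      fun h => h1.1 (by rw [h]; rfl), fun h => h1.2 (by rw [h]; rfl)⟩

/-! ### Horseshoes -/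

/-- Two disjoint intervals `[s,t]` and `[u,v]`, contained in both `(a,b)` and `(0,1)`, such that
the image under `φ` of each contains a neighbourhood of `[s,v]`. -/
def HasHorseshoe (φ : ℝ → ℝ) (a b : ℝ) : Prop :=
  ∃ s t u v : ℝ, (a < s ∧ 0 < s ∧ t < u ∧ v < b ∧ v < 1) ∧
    ∃ x₁ ∈ Icc s t, ∃ y₁ ∈ Icc s t, ∃ x₂ ∈ Icc u v, ∃ y₂ ∈ Icc u v,
      (φ x₁ < s ∧ v < φ y₁) ∧ φ x₂ < s ∧ v < φ y₂

theorem HasHorseshoe.exists_fixed_pair {φ : ℝ → ℝ} (hφ : Continuous φ) {a b : ℝ}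
    (h : HasHorseshoe φ a b) :
    ∃ w₁ w₂ : ℝ, w₁ < w₂ ∧ w₁ ∈ Ioo a b ∧ w₂ ∈ Ioo a b ∧ w₁ ∈ Ioo (0 : ℝ) 1 ∧
      w₂ ∈ Ioo (0 : ℝ) 1 ∧ φ w₁ = w₁ ∧ φ w₂ = w₂ := by
  obtain ⟨s, t, u, v, ⟨has, h0s, htu, hvb, hv1⟩, x₁, hx₁, y₁, hy₁, x₂, hx₂, y₂, hy₂,
    ⟨hφx₁, hφy₁⟩, hφx₂, hφy₂⟩ := h
  have hst := hx₁.1.trans hx₁.2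
  have huv := hx₂.1.trans hx₂.2
  obtain ⟨w₁, hw₁, hfix₁⟩ := exists_fixed_of_cross hφ (hφx₁.le.trans hx₁.1)
    (by linarith [hy₁.2] : y₁ ≤ φ y₁)
  obtain ⟨w₂, hw₂, hfix₂⟩ := exists_fixed_of_cross hφ (by linarith [hx₂.1] : φ x₂ ≤ x₂)
    (hy₂.2.trans hφy₂.le)
  have h1 := ordConnected_Icc.uIcc_subset hx₁ hy₁ hw₁
  have h2 := ordConnected_Icc.uIcc_subset hx₂ hy₂ hw₂
  have ⟨h3, h4⟩ := h1
  have ⟨h5, h6⟩ := h2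
  exact ⟨w₁, w₂, by linarith, ⟨by linarith, by linarith⟩, ⟨by linarith, by linarith⟩,
    ⟨by linarith, by linarith⟩, ⟨by linarith, by linarith⟩, hfix₁, hfix₂⟩

/-- If the values of `φ` at `a` and `b` enclose `[c,d]`, then a subinterval is mapped onto
`[c,d]`, with endpoints corresponding to endpoints. -/
theorem exists_uIcc_mapsTo_uIcc {φ : ℝ → ℝ} (hφ : Continuous φ) {a b c d : ℝ}
    (hc : c ∈ Icc (φ a) (φ b)) (hd : d ∈ Icc (φ a) (φ b)) :
    ∃ a' ∈ uIcc a b, ∃ b' ∈ uIcc a b, φ a' = c ∧ φ b' = d ∧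
      MapsTo φ (uIcc a' b') (uIcc c d) := by
  have hIVT : ∀ y ∈ Icc (φ a) (φ b), ∃ x ∈ uIcc a b, φ x = y := fun y hy =>
    intermediate_value_uIcc hφ.continuousOn (Icc_subset_uIcc hy)
  set P : Set (ℝ × ℝ) := (uIcc a b ×ˢ uIcc a b) ∩ {x | φ x.1 = c ∧ φ x.2 = d} with hP
  have hPc : IsCompact P := (isCompact_uIcc.prod isCompact_uIcc).inter_right
    ((isClosed_eq (hφ.comp continuous_fst) continuous_const).inter
      (isClosed_eq (hφ.comp continuous_snd) continuous_const))
  obtain ⟨x, hx, hxc⟩ := hIVT c hc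
  obtain ⟨y, hy, hyd⟩ := hIVT d hd
  obtain ⟨⟨a', b'⟩, ⟨⟨ha', hb'⟩, ha'c, hb'd⟩, hmin⟩ := hPc.exists_isMinOn
    ⟨(x, y), ⟨hx, hy⟩, hxc, hyd⟩
    (continuous_fst.dist continuous_snd : Continuous fun x : ℝ × ℝ => dist x.1 x.2).continuousOn
  simp only at ha' hb' ha'c hb'd
  have hmin' : ∀ x ∈ uIcc a b, ∀ y ∈ uIcc a b, φ x = c → φ y = d → dist a' b' ≤ dist x y :=
    fun x hx y hy hxc hyd => hmin (show (x, y) ∈ P from ⟨⟨hx, hy⟩, hxc, hyd⟩)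
  refine ⟨a', ha', b', hb', ha'c, hb'd, fun w hw => ?_⟩
  have hsub : uIcc a' b' ⊆ uIcc a b := uIcc_subset_uIcc ha' hb'
  have hadd : dist a' w + dist w b' = dist a' b' := by
    simp only [Real.dist_eq]
    rcases mem_uIcc.mp hw with ⟨h1, h2⟩ | ⟨h1, h2⟩
    · rw [abs_of_nonpos, abs_of_nonpos, abs_of_nonpos] <;> linarith
    · rw [abs_of_nonneg, abs_of_nonneg, abs_of_nonneg] <;> linarith
  have hle : ∀ {x y z : ℝ}, z ∈ uIcc x y → dist x z ≤ dist x y := by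
    intro x y z hz
    rw [dist_comm x z, dist_comm x y, Real.dist_eq, Real.dist_eq]
    exact abs_sub_left_of_mem_uIcc hz
  have hd' : d ∈ uIcc (φ a') (φ w) → φ w ∈ uIcc c d := by
    intro h
    obtain ⟨w', hw', hw'd⟩ := intermediate_value_uIcc hφ.continuousOn h
    have h1 := hmin' a' ha' w' (hsub (uIcc_subset_uIcc left_mem_uIcc hw hw')) ha'c hw'd
    have h2 := hle hw'
    have h3 : w = b' := dist_le_zero.mp (by linarith)
    rw [h3, hb'd]
    exact right_mem_uIcc
  have hc' : c ∈ uIcc (φ b') (φ w) → φ w ∈ uIcc c d := by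
    intro h
    obtain ⟨w', hw', hw'c⟩ := intermediate_value_uIcc hφ.continuousOn h
    have h1 := hmin' w' (hsub (uIcc_subset_uIcc right_mem_uIcc hw hw')) b' hb' hw'c hb'd
    have h2 := hle hw'
    rw [dist_comm b' w', dist_comm b' w] at h2
    have h3 : a' = w := dist_le_zero.mp (by linarith)
    rw [← h3, ha'c]
    exact left_mem_uIcc
  rw [ha'c] at hd'
  rw [hb'd] at hc'
  simp only [mem_uIcc] at hd' hc' ⊢
  grind

/-- A horseshoe has periodic points of all least periods. -/
theorem HasHorseshoe.exists_leastPeriod {φ : ℝ → ℝ} (hφ : Continuous φ) {a b : ℝ}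
    (h : HasHorseshoe φ a b) {k : ℕ} (hk : 1 ≤ k) :
    ∃ w ∈ Ioo (0 : ℝ) 1, φ^[k] w = w ∧ ∀ i, 1 ≤ i → i < k → φ^[i] w ≠ w := by
  obtain ⟨s, t, u, v, ⟨has, h0s, htu, hvb, hv1⟩, x₁, hx₁, y₁, hy₁, x₂, hx₂, y₂, hy₂,
    ⟨hφx₁, hφy₁⟩, hφx₂, hφy₂⟩ := h
  have hst := hx₁.1.trans hx₁.2
  have huv := hx₂.1.trans hx₂.2
  have key : ∀ j : ℕ, ∃ x ∈ Icc s t, ∃ y ∈ Icc s t,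
      (∀ w ∈ uIcc x y, ∀ i ≤ j, φ^[i] w ∈ Icc s t) ∧ φ^[j + 1] x < s ∧ v < φ^[j + 1] y := by
    intro j
    induction j with
    | zero =>
      refine ⟨x₁, hx₁, y₁, hy₁, fun w hw i hi => ?_, hφx₁, hφy₁⟩
      rw [Nat.le_zero.mp hi]
      exact ordConnected_Icc.uIcc_subset hx₁ hy₁ hw
    | succ j ih =>
      obtain ⟨x, hx, y, hy, hit, hxs, hyv⟩ := ih
      obtain ⟨x', hx', y', hy', hxx, hyy, hmaps⟩ := exists_uIcc_mapsTo_uIcc hφ (a := x₁) (b := y₁)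
        (c := x) (d := y) ⟨by linarith [hx.1], by linarith [hx.2]⟩
        ⟨by linarith [hy.1], by linarith [hy.2]⟩
      have hsub := ordConnected_Icc.uIcc_subset hx₁ hy₁
      refine ⟨x', hsub hx', y', hsub hy', fun w hw i hi => ?_, ?_, ?_⟩
      · cases i with
        | zero => exact hsub (uIcc_subset_uIcc hx' hy' hw)
        | succ i =>
          rw [iterate_succ_apply]
          exact hit _ (hmaps hw) i (by omega)
      · rwa [iterate_succ_apply, hxx]
      · rwa [iterate_succ_apply, hyy]
  obtain ⟨x, hx, y, hy, hit, hxs, hyv⟩ : ∃ x ∈ Icc u v, ∃ y ∈ Icc u v,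
      (∀ w ∈ uIcc x y, ∀ i, 1 ≤ i → i < k → φ^[i] w ∈ Icc s t) ∧ φ^[k] x < s ∧ v < φ^[k] y := by
    obtain rfl | hk2 := hk.eq_or_lt
    · exact ⟨x₂, hx₂, y₂, hy₂, fun w _ i _ _ => by omega, hφx₂, hφy₂⟩
    · obtain ⟨j, rfl⟩ := Nat.exists_eq_add_of_le' hk2
      obtain ⟨x, hx, y, hy, hit, hxs, hyv⟩ := key j
      obtain ⟨x', hx', y', hy', hxx, hyy, hmaps⟩ := exists_uIcc_mapsTo_uIcc hφ (a := x₂) (b := y₂)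
        (c := x) (d := y) ⟨by linarith [hx.1], by linarith [hx.2]⟩
        ⟨by linarith [hy.1], by linarith [hy.2]⟩
      have hsub := ordConnected_Icc.uIcc_subset hx₂ hy₂
      refine ⟨x', hsub hx', y', hsub hy', fun w hw i hi hik => ?_, ?_, ?_⟩
      · obtain ⟨i, rfl⟩ := Nat.exists_eq_add_of_le' hi
        rw [iterate_succ_apply]
        exact hit _ (hmaps hw) i (by omega)
      · change φ^[j + 1 + 1] x' < s
        rwa [iterate_succ_apply, hxx]
      · change v < φ^[j + 1 + 1] y'
        rwa [iterate_succ_apply, hyy]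
  obtain ⟨w, hw, hwk⟩ := exists_fixed_of_cross (hφ.iterate k) (by linarith [hx.1] : φ^[k] x ≤ x)
    (hy.2.trans hyv.le)
  have hwQ := ordConnected_Icc.uIcc_subset hx hy hw
  refine ⟨w, ⟨by linarith [hwQ.1], by linarith [hwQ.2]⟩, hwk, fun i h1 hi heq => ?_⟩
  have := (hit w hw i h1 hi).2
  rw [heq] at this
  linarith [hwQ.1]

theorem exists_leo_hasHorseshoe {f : C(unitI, unitI)} (hf : f ∈ CP) {n : ℕ} {z : unitI}
    (hz : (⇑f)^[n + 1] z = z) {a b : ℝ} (haz : a < z) (hzb : (z : ℝ) < b) {ε : ℝ} (hε : 0 < ε) :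
    ∃ g : C(unitI, unitI), Leo g ∧ dist f g < ε ∧ HasHorseshoe (lineExt g)^[n + 1] a b := by
  set A := min (ε / 2) 1 with hAdef
  have hA : 0 < A := lt_min (half_pos hε) one_pos
  have hA1 : A ≤ 1 := min_le_right _ _
  have hAε : A < ε := (min_le_left _ _).trans_lt (half_lt_self hε)
  set F := lineExt f
  obtain ⟨δ, hδ, hFδ⟩ := Metric.continuous_iff.mp (continuous_lineExt f.continuous) z (A / 16)
    (by positivity)
  set η := min (min δ (A / 16)) (min (z - a) (b - z)) with hη
  have hη0 : 0 < η := lt_min (lt_min hδ (by positivity)) (lt_min (by linarith) (by linarith))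
  have hη1 : η ≤ δ := (min_le_left _ _).trans (min_le_left _ _)
  have hη2 : η ≤ A / 16 := (min_le_left _ _).trans (min_le_right _ _)
  have hη3 : η ≤ z - a := (min_le_right _ _).trans (min_le_left _ _)
  have hη4 : η ≤ b - z := (min_le_right _ _).trans (min_le_right _ _)
  obtain ⟨s, v, hs0, hsv, hv1, hsz, hvz⟩ := exists_Icc_near z.2 hη0
  set d := (v - s) / 3 with hd
  have hd0 : 0 < d := by positivity [sub_pos.mpr hsv]
  obtain ⟨g, hg, hfg, -, hcov⟩ := exists_leo_coversNear hf hA hA1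
    (l := min d (A / 16)) (lt_min hd0 (by positivity))
  have himg : ∀ p q : ℝ, s ≤ p → q ≤ v → d ≤ q - p →
      closedBall (z : ℝ) (A / 16) ∩ Icc 0 1 ⊆ (lineExt g)^[n + 1] '' Icc p q := by
    intro p q hp hq hpq
    have h1 : closedBall (F z) (A / 16) ∩ Icc 0 1 ⊆ (lineExt g)^[1] '' Icc p q := by
      rintro y ⟨hy, hyI⟩
      refine hcov (x := p) (by linarith) (by linarith) ((min_le_left _ _).trans hpq)
        (left_mem_Icc.mpr (by linarith)) hyI ?_
      have h2 := hFδ p (by rw [Real.dist_eq, abs_lt]; constructor <;> linarith)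
      rw [dist_comm] at h2
      have h3 := dist_triangle y (F z) (F p)
      rw [mem_closedBall] at hy
      rw [← Real.dist_eq]
      linarith
    have h2 := (hcov.mono le_rfl (by linarith : A / 16 ≤ A / 8)).closedBall_iterate_subset
      (lineExt_mem f) (min_le_right _ _) (by positivity) (by linarith) (lineExt_mem f z) h1 n
    rwa [← iterate_succ_apply, lineExt_iterate_coe, hz, add_comm] at h2
  have hcross : ∀ p q : ℝ, s ≤ p → q ≤ v → d ≤ q - p → ∃ x ∈ Icc p q, ∃ y ∈ Icc p q,
      (lineExt g)^[n + 1] x < s ∧ v < (lineExt g)^[n + 1] y := by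
    intro p q hp hq hpq
    have hz0 := z.2.1
    have hz1 := z.2.2
    obtain ⟨x, hx, hxe⟩ := himg p q hp hq hpq (show max 0 ((z : ℝ) - A / 16) ∈ _ by
      rw [Real.closedBall_eq_Icc]
      exact ⟨⟨le_max_right _ _, max_le (by linarith) (by linarith)⟩,
        le_max_left _ _, max_le (by linarith) (by linarith)⟩)
    obtain ⟨y, hy, hye⟩ := himg p q hp hq hpq (show min 1 ((z : ℝ) + A / 16) ∈ _ by
      rw [Real.closedBall_eq_Icc]
      exact ⟨⟨le_min (by linarith) (by linarith), min_le_right _ _⟩,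
        le_min (by linarith) (by linarith), min_le_left _ _⟩)
    refine ⟨x, hx, y, hy, ?_, ?_⟩
    · rw [hxe]; exact max_lt hs0 (by linarith)
    · rw [hye]; exact lt_min hv1 (by linarith)
  obtain ⟨x₁, hx₁, y₁, hy₁, h1⟩ := hcross s (s + d) le_rfl (by linarith) (by linarith)
  obtain ⟨x₂, hx₂, y₂, hy₂, h2⟩ := hcross (v - d) v (by linarith) le_rfl (by linarith)
  exact ⟨g, hg, hfg.trans_lt hAε, s, s + d, v - d, v,
    ⟨by linarith, hs0, by linarith, by linarith, hv1⟩, x₁, hx₁, y₁, hy₁, x₂, hx₂, y₂, hy₂, h1, h2⟩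

/-! ### Generic maps in the closure of `CP` -/

theorem exists_mem_closure_forall_mem {X ι : Type*} [MetricSpace X] [CompleteSpace X] [Countable ι]
    {S : Set X} {O : ι → Set X} (hO : ∀ i, IsOpen (O i))
    (hd : ∀ i, ∀ f ∈ S, ∀ ε > 0, ∃ g ∈ S, g ∈ O i ∧ dist f g < ε) {f : X} (hf : f ∈ S) {ε : ℝ}
    (hε : 0 < ε) : ∃ h ∈ closure S, dist f h < ε ∧ ∀ i, h ∈ O i := by
  have : CompleteSpace (closure S) := isClosed_closure.completeSpace_coe
  have hdense : Dense (⋂ i, ((↑) : closure S → X) ⁻¹' O i) := by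
    refine dense_iInter_of_isOpen (fun i => (hO i).preimage continuous_subtype_val) fun i => ?_
    rw [Metric.dense_iff]
    rintro ⟨x, hx⟩ r hr
    obtain ⟨y, hy, hxy⟩ := Metric.mem_closure_iff.mp hx (r / 2) (half_pos hr)
    obtain ⟨g, hg, hgO, hyg⟩ := hd i y hy (r / 2) (half_pos hr)
    refine ⟨⟨g, subset_closure hg⟩, ?_, hgO⟩
    rw [mem_ball, Subtype.dist_eq, dist_comm]
    exact (dist_triangle x y g).trans_lt (by linarith)
  obtain ⟨h, hh, hhO⟩ := Metric.dense_iff.mp hdense ⟨f, subset_closure hf⟩ ε hε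
  rw [mem_ball, Subtype.dist_eq, dist_comm] at hh
  exact ⟨h, h.2, hh, fun i => mem_iInter.mp hhO i⟩

theorem continuous_iterate_eval (n : ℕ) :
    Continuous fun p : C(unitI, unitI) × unitI => (⇑p.1)^[n] p.2 := by
  induction n with
  | zero => exact continuous_snd
  | succ n ih =>
    simp only [iterate_succ_apply']
    exact continuous_fst.eval ih

theorem continuous_lineExt_iterate_apply (n : ℕ) (x : ℝ) :
    Continuous fun f : C(unitI, unitI) => (lineExt f)^[n] x := by
  induction n with
  | zero => exact continuous_const
  | succ n ih =>
    simp only [iterate_succ_apply', lineExt]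
    exact continuous_subtype_val.comp (continuous_id.eval (continuous_projIcc.comp ih))

theorem isOpen_setOf_hasHorseshoe (n : ℕ) (a b : ℝ) :
    IsOpen {f : C(unitI, unitI) | HasHorseshoe (lineExt f)^[n] a b} := by
  have hc := continuous_lineExt_iterate_apply n
  rw [isOpen_iff_mem_nhds]
  rintro f ⟨s, t, u, v, hsv, x₁, hx₁, y₁, hy₁, x₂, hx₂, y₂, hy₂, ⟨h1, h2⟩, h3, h4⟩
  filter_upwards [(isOpen_lt (hc x₁) continuous_const).mem_nhds h1,
    (isOpen_lt continuous_const (hc y₁)).mem_nhds h2,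
    (isOpen_lt (hc x₂) continuous_const).mem_nhds h3,
    (isOpen_lt continuous_const (hc y₂)).mem_nhds h4] with g h1 h2 h3 h4
  exact ⟨s, t, u, v, hsv, x₁, hx₁, y₁, hy₁, x₂, hx₂, y₂, hy₂, ⟨h1, h2⟩, h3, h4⟩

theorem isOpen_setOf_forall_iterate_ne (n : ℕ) {K : Set unitI} (hK : IsClosed K) :
    IsOpen {f : C(unitI, unitI) | ∀ x ∈ K, (⇑f)^[n] x ≠ x} := by
  have h : IsClosed {p : C(unitI, unitI) × unitI | p.2 ∈ K ∧ (⇑p.1)^[n] p.2 = p.2} :=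
    (hK.preimage continuous_snd).inter (isClosed_eq (continuous_iterate_eval n) continuous_snd)
  convert (isClosedMap_fst_of_compactSpace _ h).isOpen_compl using 1
  ext f
  simp

/-- The iterates of `f` spread `U` over all of `[0,1]` up to `δ`, and the endpoints of `[0,1]` are
not mapped to endpoints. -/
def SpreadsOver (f : unitI → unitI) (U : Set unitI) (δ : ℝ) : Prop :=
  ((f 0 ≠ 0 ∧ f 0 ≠ 1) ∧ f 1 ≠ 0 ∧ f 1 ≠ 1) ∧
    ∃ n, ∃ x ∈ U, ∃ y ∈ U, (f^[n] x : ℝ) < δ ∧ 1 - δ < (f^[n] y : ℝ)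

theorem isOpen_setOf_spreadsOver (U : Set unitI) (δ : ℝ) :
    IsOpen {f : C(unitI, unitI) | SpreadsOver f U δ} := by
  have hne : ∀ x y : unitI, IsOpen {f : C(unitI, unitI) | f x ≠ y} := fun x y =>
    isOpen_ne_fun (continuous_eval_const x) continuous_const
  refine (((hne 0 0).inter (hne 0 1)).inter ((hne 1 0).inter (hne 1 1))).inter ?_
  refine isOpen_iff_mem_nhds.mpr ?_
  rintro f ⟨n, x, hx, y, hy, h1, h2⟩
  have hc : ∀ x : unitI, Continuous fun f : C(unitI, unitI) => ((⇑f)^[n] x : ℝ) := fun x =>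
    continuous_subtype_val.comp ((continuous_iterate_eval n).comp (continuous_id.prodMk
      continuous_const))
  filter_upwards [(isOpen_lt (hc x) continuous_const).mem_nhds h1,
    (isOpen_lt continuous_const (hc y)).mem_nhds h2] with g h1 h2
  exact ⟨n, x, hx, y, hy, h1, h2⟩

theorem surjective_of_mem_closure_CP {h : C(unitI, unitI)} (hh : h ∈ closure CP) :
    Surjective h := by
  intro y
  have hcl : IsClosed (range h) := (isCompact_range h.continuous).isClosed
  have : y ∈ closure (range h) := by
    rw [Metric.mem_closure_iff]
    intro ε hε
    obtain ⟨f, hf, hhf⟩ := Metric.mem_closure_iff.mp hh ε hε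
    obtain ⟨x, rfl⟩ := hf.1 y
    refine ⟨h x, mem_range_self x, ?_⟩
    rw [dist_comm]
    exact (ContinuousMap.dist_apply_le_dist x).trans_lt hhf
  rwa [hcl.closure_eq] at this

theorem leo_of_spreadsOver {h : C(unitI, unitI)} (hs : Surjective h)
    (H : ∀ U ∈ TopologicalSpace.countableBasis unitI, ∀ m : ℕ, SpreadsOver h U (1 / (m + 1))) :
    Leo h := by
  refine leo_of_lineExt fun s t h0 hst h1 => ?_
  obtain ⟨U, hU, -, hUst⟩ :=
    (TopologicalSpace.isBasis_countableBasis unitI).exists_subset_of_mem_open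
    (a := ⟨(s + t) / 2, by constructor <;> linarith⟩) (u := {x | s < (x : ℝ) ∧ (x : ℝ) < t})
    (by constructor <;> simp <;> linarith)
    ((isOpen_lt continuous_const continuous_subtype_val).inter
        (isOpen_lt continuous_subtype_val continuous_const))
  obtain ⟨⟨⟨h00, h01⟩, h10, h11⟩, -⟩ := H U hU 0
  obtain ⟨p, hp⟩ := hs 0
  obtain ⟨q, hq⟩ := hs 1
  have hI : ∀ x : unitI, x ≠ 0 → x ≠ 1 → 0 < (x : ℝ) ∧ (x : ℝ) < 1 := fun x hx0 hx1 =>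
    ⟨lt_of_le_of_ne x.2.1 fun h => hx0 (Subtype.ext h.symm),
      lt_of_le_of_ne x.2.2 fun h => hx1 (Subtype.ext h)⟩
  obtain ⟨hp0, hp1⟩ := hI p (fun h => h00 (h ▸ hp)) (fun h => h10 (h ▸ hp))
  obtain ⟨hq0, hq1⟩ := hI q (fun h => h01 (h ▸ hq)) (fun h => h11 (h ▸ hq))
  obtain ⟨m, hm⟩ := exists_nat_one_div_lt
    (lt_min (lt_min hp0 (sub_pos.mpr hp1)) (lt_min hq0 (sub_pos.mpr hq1)))
  simp only [lt_min_iff] at hm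
  obtain ⟨-, n, x, hx, y, hy, hxn, hyn⟩ := H U hU m
  have hc := continuous_lineExt_iterate h.continuous
  have hxst := hUst hx
  have hyst := hUst hy
  have hsub : uIcc (x : ℝ) y ⊆ Icc s t := ordConnected_Icc.uIcc_subset
    ⟨hxst.1.le, hxst.2.le⟩ ⟨hyst.1.le, hyst.2.le⟩
  have key : ∀ w : unitI, 1 / ((m : ℝ) + 1) < w → 1 / ((m : ℝ) + 1) < 1 - w →
      (w : ℝ) ∈ (lineExt h)^[n] '' Icc s t := by
    intro w hw0 hw1
    refine image_mono hsub (intermediate_value_uIcc (hc n).continuousOn (Icc_subset_uIcc ?_))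
    rw [lineExt_iterate_coe, lineExt_iterate_coe]
    constructor <;> linarith
  obtain ⟨p', hp', hpp⟩ := key p hm.1.1 hm.1.2
  obtain ⟨q', hq', hqq⟩ := key q hm.2.1 hm.2.2
  refine ⟨n + 1, fun y hy => ?_⟩
  refine image_mono (ordConnected_Icc.uIcc_subset hp' hq')
    (intermediate_value_uIcc (hc (n + 1)).continuousOn (Icc_subset_uIcc ?_))
  rw [iterate_succ_apply', iterate_succ_apply', hpp, hqq, lineExt_coe, lineExt_coe, hp, hq]
  exact hy

theorem exists_hasHorseshoe_near {h : C(unitI, unitI)} {n : ℕ}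
    (H : ∀ i m : ℕ, (∀ x ∈ closedBall (TopologicalSpace.denseSeq unitI i) (1 / (m + 1)),
      (⇑h)^[n + 1] x ≠ x) ∨ HasHorseshoe (lineExt h)^[n + 1]
        (TopologicalSpace.denseSeq unitI i - 2 * (1 / (m + 1)))
        (TopologicalSpace.denseSeq unitI i + 2 * (1 / (m + 1))))
    {z : unitI} (hz : (⇑h)^[n + 1] z = z) {ε : ℝ} (hε : 0 < ε) :
    ∃ a b : ℝ, (z : ℝ) - ε < a ∧ b < z + ε ∧ HasHorseshoe (lineExt h)^[n + 1] a b := by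
  obtain ⟨m, hm⟩ := exists_nat_one_div_lt (show 0 < ε / 3 by positivity)
  have hm0 : 0 < 1 / ((m : ℝ) + 1) := by positivity
  obtain ⟨i, hi⟩ := (TopologicalSpace.denseRange_denseSeq unitI).exists_dist_lt z hm0
  rcases H i m with hne | hor
  · exact absurd hz (hne z (mem_closedBall.mpr hi.le))
  · rw [Subtype.dist_eq, Real.dist_eq, abs_lt] at hi
    exact ⟨_, _, by linarith, by linarith, hor⟩

theorem perfect_setOf_iterate_eq {h : C(unitI, unitI)} {n : ℕ}
    (H : ∀ z : unitI, (⇑h)^[n] z = z → ∀ ε : ℝ, 0 < ε →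
      ∃ a b : ℝ, (z : ℝ) - ε < a ∧ b < z + ε ∧ HasHorseshoe (lineExt h)^[n] a b) :
    Perfect {x : unitI | (⇑h)^[n] x = x} := by
  refine ⟨isClosed_eq (h.continuous.iterate n) continuous_id, ?_⟩
  rw [preperfect_iff_nhds]
  intro z hz U hU
  obtain ⟨ε, hε, hb⟩ := Metric.mem_nhds_iff.mp hU
  obtain ⟨a, b, ha, hb', hor⟩ := H z hz ε hε
  obtain ⟨w₁, w₂, hlt, h1, h2, hI1, hI2, hf1, hf2⟩ :=
    hor.exists_fixed_pair (continuous_lineExt_iterate h.continuous n)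
  have key : ∀ w : ℝ, w ∈ Ioo a b → ∀ hI : w ∈ Ioo (0 : ℝ) 1, (lineExt h)^[n] w = w →
      (⟨w, hI.1.le, hI.2.le⟩ : unitI) ∈ U ∩ {x | (⇑h)^[n] x = x} := by
    intro w hw hI hf
    refine ⟨hb ?_, Subtype.ext ?_⟩
    · rw [mem_ball, Subtype.dist_eq, Real.dist_eq, abs_lt]
      constructor <;> linarith [hw.1, hw.2]
    · rw [← lineExt_iterate_coe]
      exact hf
  by_cases hzw : (z : ℝ) = w₁
  · exact ⟨_, key w₂ h2 hI2 hf2, fun h => hlt.ne (hzw.symm.trans (congrArg Subtype.val h).symm)⟩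
  · exact ⟨_, key w₁ h1 hI1 hf1, fun h => hzw (congrArg Subtype.val h).symm⟩

/-- Every map in `CP` is approximated by locally eventually onto maps with periodic points of all
least periods, all of whose fixed point sets of iterates are perfect. -/
theorem exists_leo_perfect_periodic {f : C(unitI, unitI)} (hf : f ∈ CP) {ε : ℝ} (hε : 0 < ε) :
    ∃ h : C(unitI, unitI), dist f h < ε ∧ Leo h ∧
      (∀ n, Perfect {x : unitI | (⇑h)^[n + 1] x = x}) ∧ ∀ k, 1 ≤ k → (PerSet h k).Nonempty := by
  let O : (TopologicalSpace.countableBasis unitI × ℕ) ⊕ (ℕ × ℕ × ℕ) → Set C(unitI, unitI) :=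
    Sum.elim (fun j => {f | SpreadsOver f j.1 (1 / (j.2 + 1))})
      (fun j => {f | ∀ x ∈ closedBall (TopologicalSpace.denseSeq unitI j.2.1) (1 / (j.2.2 + 1)),
          (⇑f)^[j.1 + 1] x ≠ x} ∪
        {f | HasHorseshoe (lineExt f)^[j.1 + 1]
          (TopologicalSpace.denseSeq unitI j.2.1 - 2 * (1 / (j.2.2 + 1)))
          (TopologicalSpace.denseSeq unitI j.2.1 + 2 * (1 / (j.2.2 + 1)))})
  have hO : ∀ j, IsOpen (O j) := by
    rintro (j | j)
    · exact isOpen_setOf_spreadsOver _ _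
    · exact (isOpen_setOf_forall_iterate_ne _ isClosed_closedBall).union
        (isOpen_setOf_hasHorseshoe _ _ _)
  have hd : ∀ j, ∀ f ∈ CP, ∀ ε > 0, ∃ g ∈ CP, g ∈ O j ∧ dist f g < ε := by
    rintro (⟨⟨U, hU⟩, m⟩ | ⟨n, i, m⟩) f hf ε hε
    · obtain ⟨g, hg, hfg, hend, -⟩ := exists_leo_coversNear hf (A := min (ε / 2) 1)
        (lt_min (half_pos hε) one_pos) (min_le_right _ _) one_pos
      refine ⟨g, hg.mem_CP, ⟨hend, ?_⟩,
        (hfg.trans (min_le_left _ _)).trans_lt (half_lt_self hε)⟩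
      obtain ⟨n, hn⟩ := hg U (TopologicalSpace.isOpen_of_mem_countableBasis hU)
        (TopologicalSpace.nonempty_of_mem_countableBasis hU)
      obtain ⟨x, hx, hx'⟩ : (0 : unitI) ∈ (⇑g)^[n] '' U := hn ▸ mem_univ _
      obtain ⟨y, hy, hy'⟩ : (1 : unitI) ∈ (⇑g)^[n] '' U := hn ▸ mem_univ _
      have : (0 : ℝ) < 1 / (m + 1) := by positivity
      exact ⟨n, x, hx, y, hy, by rw [hx']; simpa using this, by rw [hy']; simpa using this⟩
    · by_cases hne : ∀ x ∈ closedBall (TopologicalSpace.denseSeq unitI i) (1 / (m + 1)),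
          (⇑f)^[n + 1] x ≠ x
      · exact ⟨f, hf, Or.inl hne, by simpa using hε⟩
      · push Not at hne
        obtain ⟨z, hz, hfz⟩ := hne
        have hm0 : (0 : ℝ) < 1 / (m + 1) := by positivity
        rw [mem_closedBall, Subtype.dist_eq, Real.dist_eq, abs_le] at hz
        obtain ⟨g, hg, hfg, hor⟩ := exists_leo_hasHorseshoe hf hfz
          (a := TopologicalSpace.denseSeq unitI i - 2 * (1 / (m + 1)))
          (b := TopologicalSpace.denseSeq unitI i + 2 * (1 / (m + 1)))
          (by linarith) (by linarith) hε
        exact ⟨g, hg.mem_CP, Or.inr hor, hfg⟩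
  obtain ⟨h, hcl, hfh, hhO⟩ := exists_mem_closure_forall_mem hO hd hf hε
  have hor : ∀ n, ∀ z : unitI, (⇑h)^[n + 1] z = z → ∀ ε : ℝ, 0 < ε →
      ∃ a b : ℝ, (z : ℝ) - ε < a ∧ b < z + ε ∧ HasHorseshoe (lineExt h)^[n + 1] a b :=
    fun n z hz ε hε => exists_hasHorseshoe_near (fun i m => hhO (Sum.inr (n, i, m))) hz hε
  refine ⟨h, hfh, leo_of_spreadsOver (surjective_of_mem_closure_CP hcl)
    fun U hU m => hhO (Sum.inl (⟨U, hU⟩, m)), fun n => perfect_setOf_iterate_eq (hor n),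
    fun k hk => ?_⟩
  obtain ⟨z, -, hz⟩ := exists_fixed_of_cross (continuous_lineExt h.continuous) (u := 1) (v := 0)
    (lineExt_mem h 1).2 (lineExt_mem h 0).1
  have hzI : z ∈ Icc (0 : ℝ) 1 := hz ▸ lineExt_mem h z
  obtain ⟨a, b, -, -, hab⟩ := hor 0 ⟨z, hzI⟩
    (Subtype.ext ((lineExt_coe h ⟨z, hzI⟩).symm.trans hz)) 1 one_pos
  obtain ⟨w, hw, hwk, hwi⟩ := hab.exists_leastPeriod (continuous_lineExt h.continuous) hk
  have hit : ∀ i, ((⇑h)^[i] ⟨w, hw.1.le, hw.2.le⟩ : ℝ) = (lineExt h)^[i] w := fun i =>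
    (lineExt_iterate_coe h i ⟨w, hw.1.le, hw.2.le⟩).symm
  exact ⟨⟨w, hw.1.le, hw.2.le⟩, Subtype.ext ((hit k).trans hwk),
    fun i h1 hi heq => hwi i h1 hi ((hit i).symm.trans (congrArg Subtype.val heq))⟩

/-! ### Atomless measures and reparametrizations of the interval -/

theorem Perfect.not_countable_inter_isOpen {C V : Set unitI} (hC : Perfect C) (hV : IsOpen V)
    (hne : (V ∩ C).Nonempty) : ¬ (V ∩ C).Countable := by
  obtain ⟨x, hxV, hxC⟩ := hne
  obtain ⟨r, hr, hb⟩ := Metric.isOpen_iff.mp hV x hxV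
  obtain ⟨hperf, hne⟩ := hC.closure_nhds_inter x hxC (mem_ball_self (half_pos hr)) isOpen_ball
  obtain ⟨c, hc, -, hinj⟩ := hperf.exists_nat_bool_injection hne
  have hsub : range c ⊆ V ∩ C := fun y hy =>
    ⟨hb (closedBall_subset_ball (half_lt_self hr) (closure_ball_subset_closedBall
      (closure_mono inter_subset_left (hc hy)))),
      hC.closed.closure_eq ▸ closure_mono inter_subset_right (hc hy)⟩
  intro h
  have := countable_univ_iff.mp (countable_of_injective_of_countable_image hinj.injOn
    (image_univ ▸ h.mono hsub))
  obtain ⟨e, he⟩ := exists_surjective_nat (ℕ → Bool)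
  obtain ⟨n, hn⟩ := he fun n => !(e n n)
  simpa using congrFun hn n

theorem exists_isProbabilityMeasure_of_not_countable {S : Set unitI} (hS : MeasurableSet S)
    (hc : ¬ S.Countable) :
    ∃ ν : Measure unitI, IsProbabilityMeasure ν ∧ NullSingletonClass ν ∧ ν Sᶜ = 0 := by
  have : StandardBorelSpace S := hS.standardBorel
  have hI : ¬ Countable unitI := by
    intro h
    have h1 : volume (univ : Set unitI) = 0 := countable_univ.measure_zero _
    simp at h1
  let e := PolishSpace.measurableEquivOfNotCountable hI (β := S) hc
  have he : Measurable fun x => (e x : unitI) := measurable_subtype_coe.comp e.measurable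
  refine ⟨volume.map fun x => (e x : unitI), Measure.isProbabilityMeasure_map he.aemeasurable,
    ⟨fun x => ?_⟩, ?_⟩
  · rw [Measure.map_apply he (measurableSet_singleton x)]
    refine Set.Subsingleton.measure_zero (fun y hy z hz => ?_) _
    exact e.injective (Subtype.ext (hy.trans hz.symm))
  · rw [Measure.map_apply he hS.compl]
    convert measure_empty (μ := (volume : Measure unitI))
    ext x
    simp

theorem continuous_measureReal_Iic (μ : Measure unitI) [IsFiniteMeasure μ] [NullSingletonClass μ] :
    Continuous fun x : unitI => μ.real (Iic x) := by
  set M : Measure ℝ := μ.map (↑) with hM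
  have hMn : NullSingletonClass M := ⟨fun x => by
    rw [hM, Measure.map_apply measurable_subtype_coe (measurableSet_singleton x)]
    exact Set.Subsingleton.measure_zero (fun y hy z hz => Subtype.ext (hy.trans hz.symm)) _⟩
  have h := (intervalIntegral.continuous_primitive (μ := M) (f := fun _ => (1 : ℝ))
    (fun a b => intervalIntegrable_const) (-1)).comp (continuous_subtype_val (p := (· ∈ Icc 0 1)))
  refine h.congr fun x => ?_
  have hx : (-1 : ℝ) ≤ x := by linarith [x.2.1]
  simp only [comp_apply, intervalIntegral.integral_const', Ioc_eq_empty_of_le hx,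
    measureReal_empty, sub_zero, smul_eq_mul, mul_one]
  rw [hM, map_measureReal_apply measurable_subtype_coe measurableSet_Ioc]
  congr 1
  ext y
  have := y.2.1
  simp only [mem_preimage, mem_Ioc, mem_Iic, Subtype.coe_le_coe, and_iff_right_iff_imp]
  intro
  linarith

/-- The distribution function of an atomless probability measure of full support is an order
isomorphism of `[0,1]`, carrying the measure to Lebesgue measure. -/
theorem exists_orderIso_map_eq_volume (μ : Measure unitI) [IsProbabilityMeasure μ]
    [NullSingletonClass μ] [μ.IsOpenPosMeasure] :
    ∃ φ : unitI ≃o unitI, (∀ x, (φ x : ℝ) = μ.real (Iic x)) ∧ μ.map φ = volume := by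
  let F : unitI → unitI := fun x => ⟨μ.real (Iic x), measureReal_nonneg, measureReal_le_one⟩
  have hFc : Continuous F := (continuous_measureReal_Iic μ).subtype_mk _
  have hFm : StrictMono F := by
    intro x y hxy
    have h1 : μ.real (Iic y) = μ.real (Iic x) + μ.real (Ioc x y) := by
      rw [← Iic_union_Ioc_eq_Iic hxy.le, measureReal_union (Iic_disjoint_Ioc le_rfl)
        measurableSet_Ioc]
    have h2 : 0 < μ.real (Ioc x y) :=
      ENNReal.toReal_pos ((isOpen_Ioo.measure_pos μ (nonempty_Ioo.mpr hxy)).trans_le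
        (measure_mono Ioo_subset_Ioc_self)).ne' (measure_ne_top _ _)
    exact Subtype.coe_lt_coe.mp (show μ.real (Iic x) < μ.real (Iic y) by linarith)
  have hFs : Surjective F := by
    intro y
    refine mem_range_of_exists_le_of_exists_ge hFc ⟨0, ?_⟩ ⟨1, ?_⟩
    · refine Subtype.coe_le_coe.mp (le_trans (le_of_eq ?_) y.2.1)
      have : Iic (0 : unitI) = {0} := Iic_bot
      simp [F, this, measureReal_def]
    · refine Subtype.coe_le_coe.mp (y.2.2.trans (le_of_eq ?_))
      have : Iic (1 : unitI) = univ := Iic_top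
      simp [F, this]
  let φ := hFm.orderIsoOfSurjective F hFs
  have hφ : ∀ x, (φ x : ℝ) = μ.real (Iic x) := fun x => rfl
  have hφm : Measurable φ := φ.monotone.measurable
  have := Measure.isProbabilityMeasure_map (μ := μ) hφm.aemeasurable
  refine ⟨φ, hφ, Measure.ext_of_Iic _ _ fun a => ?_⟩
  rw [Measure.map_apply hφm measurableSet_Iic, unitInterval.volume_Iic, φ.preimage_Iic,
    ← ENNReal.ofReal_toReal (measure_ne_top μ _)]
  congr 1
  rw [← measureReal_def, ← hφ, φ.apply_symm_apply]

/-- An atomless measure of full support is equivalent to a probability measure whose distribution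
function is uniformly close to the identity. -/
theorem exists_equiv_measure_abs_Iic_sub_le (μ₀ : Measure unitI) [IsFiniteMeasure μ₀]
    [NullSingletonClass μ₀] [μ₀.IsOpenPosMeasure] {N : ℕ} (hN : 0 < N) :
    ∃ μ : Measure unitI, IsProbabilityMeasure μ ∧ μ ≪ μ₀ ∧ μ₀ ≪ μ ∧
      ∀ x : unitI, |μ.real (Iic x) - x| ≤ 1 / N := by
  have hN' : (0 : ℝ) < N := Nat.cast_pos.mpr hN
  let c : ℕ → Set unitI := fun j => {x | (x : ℝ) ∈ Ioc ((j : ℝ) / N) ((j + 1) / N)}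
  have hc : ∀ j, MeasurableSet (c j) := fun j => measurable_subtype_coe measurableSet_Ioc
  have hc0 : ∀ j < N, μ₀ (c j) ≠ 0 := by
    intro j hj
    have hjN : ((j : ℝ) + 1) / N ≤ 1 := by
      rw [div_le_one hN']; exact_mod_cast hj
    have hlt : (j : ℝ) / N < (j + 1) / N := by gcongr; linarith
    have hj0 : 0 ≤ (j : ℝ) / N := by positivity
    obtain ⟨x, hx1, hx2⟩ := exists_between hlt
    have ho : IsOpen {x : unitI | (x : ℝ) ∈ Ioo ((j : ℝ) / N) ((j + 1) / N)} :=
      isOpen_Ioo.preimage continuous_subtype_val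
    exact ((ho.measure_pos μ₀ ⟨⟨x, by linarith, by linarith⟩, hx1, hx2⟩).trans_le
      (measure_mono (show _ ⊆ c j from fun y hy => ⟨hy.1, hy.2.le⟩))).ne'
  let μ : Measure unitI :=
    (N : ENNReal)⁻¹ • ∑ j ∈ Finset.range N, ProbabilityTheory.cond μ₀ (c j)
  have hμ : ∀ s, μ s = (N : ENNReal)⁻¹ * ∑ j ∈ Finset.range N, (μ₀ (c j))⁻¹ * μ₀ (c j ∩ s) := by
    intro s
    simp only [μ, Measure.smul_apply, Measure.finsetSum_apply, smul_eq_mul]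
    congr 1
    exact Finset.sum_congr rfl fun j _ => ProbabilityTheory.cond_apply (hc j) μ₀ s
  have hμj : ∀ j ≤ N, μ {x | (x : ℝ) ≤ j / N} = (N : ENNReal)⁻¹ * j := by
    intro j hj
    rw [hμ]
    congr 1
    have : ∀ i ∈ Finset.range N, (μ₀ (c i))⁻¹ * μ₀ (c i ∩ {x | (x : ℝ) ≤ j / N}) =
        if i < j then 1 else 0 := by
      intro i hi
      split_ifs with hij
      · have hle : ((i : ℝ) + 1) / N ≤ j / N := by
          gcongr
          exact_mod_cast hij
        rw [inter_eq_left.mpr fun x hx => hx.2.trans hle,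
          ENNReal.inv_mul_cancel (hc0 i (Finset.mem_range.mp hi)) (measure_ne_top _ _)]
      · convert mul_zero _
        convert measure_empty (μ := μ₀)
        refine eq_empty_of_forall_notMem fun x hx => ?_
        have h1 : (i : ℝ) / N < j / N := hx.1.1.trans_le hx.2
        rw [div_lt_div_iff_of_pos_right hN'] at h1
        exact hij (by exact_mod_cast h1)
    rw [Finset.sum_congr rfl this, Finset.sum_boole]
    congr 1
    rw [show Finset.filter (· < j) (Finset.range N) = Finset.range j by
      ext i; simp only [Finset.mem_filter, Finset.mem_range]; omega, Finset.card_range]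
  have hprob : IsProbabilityMeasure μ := ⟨by
    have h := hμj N le_rfl
    rw [ENNReal.inv_mul_cancel (by exact_mod_cast hN.ne') (ENNReal.natCast_ne_top N)] at h
    rw [← h]
    congr 1
    ext x
    simpa [div_self hN'.ne'] using x.2.2⟩
  have hμr : ∀ j ≤ N, μ.real {x | (x : ℝ) ≤ j / N} = j / N := by
    intro j hj
    rw [measureReal_def, hμj j hj]
    simp [div_eq_inv_mul]
  refine ⟨μ, hprob, fun s hs => ?_, fun s hs => ?_, fun x => ?_⟩
  · rw [hμ]
    simp [measure_inter_null_of_null_right _ hs]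
  · rw [hμ] at hs
    simp only [mul_eq_zero, ENNReal.inv_eq_zero, ENNReal.natCast_ne_top, false_or,
      Finset.sum_eq_zero_iff, Finset.mem_range, measure_ne_top] at hs
    refine measure_mono_null (t := {0} ∪ ⋃ j ∈ Finset.range N, c j ∩ s) (fun x hx => ?_)
      (measure_union_null (measure_singleton 0) ?_)
    · rcases x.2.1.eq_or_lt with h0 | h0
      · exact Or.inl (Subtype.ext h0.symm)
      · right
        have hpos : 0 < (x : ℝ) * N := by positivity
        have hceil := Nat.ceil_lt_add_one hpos.le
        have hceil' := Nat.le_ceil ((x : ℝ) * N)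
        have hceil0 := Nat.ceil_pos.mpr hpos
        have hceilN : ⌈(x : ℝ) * N⌉₊ ≤ N := Nat.ceil_le.mpr (by nlinarith [x.2.2])
        obtain ⟨j, hj⟩ := Nat.exists_eq_add_of_le' hceil0
        rw [hj] at hceil hceil' hceilN
        push_cast at hceil hceil'
        simp only [mem_iUnion, Finset.mem_range]
        refine ⟨j, hceilN, ⟨?_, ?_⟩, hx⟩
        · rw [div_lt_iff₀ hN']; linarith
        · rw [le_div_iff₀ hN']; linarith
    · exact (measure_biUnion_null_iff (Finset.range N).countable_toSet).mpr fun j hj =>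
        hs j (Finset.mem_range.mp hj)
  · set j := ⌊(x : ℝ) * N⌋₊ with hj
    have hx0 := x.2.1
    have hx1 := x.2.2
    have h1 : (j : ℝ) ≤ x * N := Nat.floor_le (by positivity)
    have h2 : (x : ℝ) * N < j + 1 := Nat.lt_floor_add_one _
    have hjN : j ≤ N := by
      have : (j : ℝ) ≤ N := by nlinarith
      exact_mod_cast this
    rw [← div_le_iff₀ hN'] at h1
    rw [← lt_div_iff₀ hN', add_div] at h2
    have hlow : (j : ℝ) / N ≤ μ.real (Iic x) := by
      rw [← hμr j hjN]
      exact measureReal_mono fun y hy => Subtype.coe_le_coe.mp (hy.trans h1)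
    have hup : μ.real (Iic x) ≤ (j : ℝ) / N + 1 / N := by
      rcases hjN.eq_or_lt with hjN | hjN
      · rw [hjN, div_self hN'.ne']
        exact measureReal_le_one.trans (by simp)
      · rw [← add_div]
        have := hμr (j + 1) hjN
        push_cast at this
        rw [← this, add_div]
        exact measureReal_mono fun y hy => (Subtype.coe_le_coe.mpr hy).trans h2.le
    rw [abs_le]
    constructor <;> linarith

theorem isOpen_setOf_forall_iterate_lt_ne {h : unitI → unitI} (hh : Continuous h) (k : ℕ) :
    IsOpen {x | ∀ i, 1 ≤ i → i < k → h^[i] x ≠ x} := by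
  have : {x | ∀ i, 1 ≤ i → i < k → h^[i] x ≠ x} = ⋂ i ∈ Finset.Ico 1 k, {x | h^[i] x ≠ x} := by
    ext x
    simp
  rw [this]
  exact isOpen_biInter_finset fun i _ => isOpen_ne_fun (hh.iterate i) continuous_id

theorem mem_PerSet_minimalPeriod (h : unitI → unitI) (x : unitI) :
    x ∈ PerSet h (minimalPeriod h x) :=
  ⟨isPeriodicPt_minimalPeriod h x, fun _ hi hlt =>
    not_isPeriodicPt_of_pos_of_lt_minimalPeriod (Nat.one_le_iff_ne_zero.mp hi) hlt⟩

/-- If the fixed point sets of all iterates are perfect and periodic points are dense, then there is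
an atomless measure of full support concentrated on the periodic points and charging all least
periods which occur. -/
theorem exists_measure_periodic {h : C(unitI, unitI)} (hd : Dense (periodicPts h))
    (hperf : ∀ n, Perfect {x : unitI | (⇑h)^[n + 1] x = x})
    (hne : ∀ k, 1 ≤ k → (PerSet h k).Nonempty) :
    ∃ μ : Measure unitI, IsFiniteMeasure μ ∧ NullSingletonClass μ ∧ μ.IsOpenPosMeasure ∧
      μ (PerAll h)ᶜ = 0 ∧ ∀ k, 1 ≤ k → μ (PerSet h k) ≠ 0 := by
  have key : ∀ j : TopologicalSpace.countableBasis unitI × ℕ, ∃ ν : Measure unitI,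
      IsFiniteMeasure ν ∧ NullSingletonClass ν ∧ ν (j.1 ∩ PerSet h (j.2 + 1))ᶜ = 0 ∧
        ((j.1 ∩ PerSet h (j.2 + 1) : Set unitI).Nonempty →
          ν (j.1 ∩ PerSet h (j.2 + 1)) ≠ 0) := by
    rintro ⟨⟨U, hU⟩, k⟩
    by_cases hS : (U ∩ PerSet h (k + 1)).Nonempty
    · have hV : IsOpen (U ∩ {x | ∀ i, 1 ≤ i → i < k + 1 → (⇑h)^[i] x ≠ x}) :=
        (TopologicalSpace.isOpen_of_mem_countableBasis hU).inter
          (isOpen_setOf_forall_iterate_lt_ne h.continuous _)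
      have heq : U ∩ PerSet h (k + 1) =
          (U ∩ {x | ∀ i, 1 ≤ i → i < k + 1 → (⇑h)^[i] x ≠ x}) ∩ {x | (⇑h)^[k + 1] x = x} := by
        ext x
        simp only [PerSet, mem_inter_iff, mem_ofPred_eq]
        tauto
      have hm : MeasurableSet (U ∩ PerSet h (k + 1)) := by
        rw [heq]
        exact hV.measurableSet.inter (hperf k).closed.measurableSet
      obtain ⟨ν, hν, hνs, hνS⟩ := exists_isProbabilityMeasure_of_not_countable hm
        (heq ▸ (hperf k).not_countable_inter_isOpen hV (heq ▸ hS))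
      refine ⟨ν, inferInstance, hνs, hνS, fun _ h0 => ?_⟩
      have := measure_add_measure_compl (μ := ν) hm
      rw [h0, hνS, measure_univ] at this
      simp at this
    · exact ⟨0, inferInstance, ⟨fun x => by simp⟩, by simp, fun h => absurd h hS⟩
  choose ν hνf hνs hν0 hνp using key
  have hsum : ∀ j : TopologicalSpace.countableBasis unitI × ℕ,
      (j.1 ∩ PerSet h (j.2 + 1) : Set unitI).Nonempty → ∀ s : Set unitI,
      (j.1 ∩ PerSet h (j.2 + 1) : Set unitI) ⊆ s → (Measure.sum ν).toFinite s ≠ 0 := by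
    intro j hj s hs h0
    rw [toFinite_apply_eq_zero_iff] at h0
    exact hνp j hj (measure_mono_null hs (Measure.le_sum ν j |>.absolutelyContinuous h0))
  have hzero : ∀ s : Set unitI, (∀ j, ν j s = 0) → (Measure.sum ν).toFinite s = 0 := by
    intro s hs
    rw [toFinite_apply_eq_zero_iff, Measure.sum_apply_of_countable]
    simp [hs]
  refine ⟨(Measure.sum ν).toFinite, inferInstance,
    ⟨fun x => hzero _ fun j => (hνs j).measure_singleton x⟩, ⟨fun V hV hVne => ?_⟩,
    hzero _ fun j => measure_mono_null ?_ (hν0 j), fun k hk => ?_⟩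
  · obtain ⟨x, hx⟩ := hVne
    obtain ⟨U, hU, hxU, hUV⟩ :=
      (TopologicalSpace.isBasis_countableBasis unitI).exists_subset_of_mem_open hx hV
    obtain ⟨y, hyU, hy⟩ := hd.inter_open_nonempty U
      (TopologicalSpace.isOpen_of_mem_countableBasis hU) ⟨x, hxU⟩
    obtain ⟨k, hk⟩ := Nat.exists_eq_add_of_le' (minimalPeriod_pos_of_mem_periodicPts hy)
    exact hsum (⟨U, hU⟩, k) ⟨y, hyU, hk ▸ mem_PerSet_minimalPeriod h y⟩ V
      (inter_subset_left.trans hUV)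
  · exact compl_subset_compl.mpr fun x hx =>
      mem_biUnion (show 1 ≤ j.2 + 1 by omega) hx.2
  · obtain ⟨k, rfl⟩ := Nat.exists_eq_add_of_le' hk
    obtain ⟨x, hx⟩ := hne (k + 1) hk
    obtain ⟨U, hU, hxU, -⟩ :=
      (TopologicalSpace.isBasis_countableBasis unitI).exists_subset_of_mem_open (mem_univ x)
        isOpen_univ
    exact hsum (⟨U, hU⟩, k) ⟨x, hxU, hx⟩ _ inter_subset_right

theorem Leo.of_semiconj {φ : unitI ≃ₜ unitI} {h g : unitI → unitI} (hφ : Semiconj φ h g)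
    (hh : Leo h) : Leo g := by
  intro U hU hne
  obtain ⟨x, hx⟩ := hne
  obtain ⟨n, hn⟩ := hh (φ ⁻¹' U) (hU.preimage φ.continuous) ⟨φ.symm x, by simpa using hx⟩
  refine ⟨n, eq_univ_of_forall fun y => ?_⟩
  obtain ⟨z, hz, hzy⟩ : φ.symm y ∈ h^[n] '' (φ ⁻¹' U) := hn ▸ mem_univ _
  refine ⟨φ z, hz, ?_⟩
  rw [← hφ.iterate_right n z, hzy, φ.apply_symm_apply]

theorem PerSet_eq_preimage_of_semiconj {φ : unitI ≃ₜ unitI} {h g : unitI → unitI}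
    (hφ : Semiconj φ h g) (k : ℕ) : PerSet h k = φ ⁻¹' PerSet g k := by
  have hit : ∀ n x, g^[n] (φ x) = φ x ↔ h^[n] x = x := fun n x => by
    rw [← hφ.iterate_right n x, φ.injective.eq_iff]
  ext x
  simp only [PerSet, mem_preimage, mem_ofPred_eq, hit, ne_eq]

/-- The set of locally eventually onto maps `f ∈ CP` whose periodic points have full
Lebesgue measure, and whose periodic points of period `k` have positive Lebesgue
measure for every `k ≥ 1`, is dense in `(CP, ρ)`. -/
theorem leo_full_measure_periodic_dense_in_CP :
    ∀ f ∈ CP, ∀ ε : ℝ, 0 < ε →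
      ∃ g ∈ CP, dist f g < ε ∧ Leo ⇑g ∧
        volume (((↑) '' PerAll ⇑g : Set ℝ)) = 1 ∧
        ∀ k : ℕ, 1 ≤ k → 0 < volume (((↑) '' PerSet ⇑g k : Set ℝ)) := by
  intro f hf ε hε
  obtain ⟨h, hfh, hleo, hperf, hne⟩ := exists_leo_perfect_periodic hf (half_pos hε)
  obtain ⟨μ₀, _, _, _, hper, hpos⟩ := exists_measure_periodic hleo.mem_CP.2 hperf hne
  obtain ⟨δ, hδ, hhδ⟩ := Metric.uniformContinuous_iff.mp
    (CompactSpace.uniformContinuous_of_continuous h.continuous) (ε / 8) (by positivity)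
  obtain ⟨N, hN⟩ := exists_nat_one_div_lt (lt_min hδ (show 0 < ε / 8 by positivity))
  obtain ⟨μ, _, hμ, hμ', hclose⟩ := exists_equiv_measure_abs_Iic_sub_le μ₀ N.succ_pos
  have : μ.IsOpenPosMeasure := hμ'.isOpenPosMeasure
  have : NullSingletonClass μ := ⟨fun x => hμ (measure_singleton x)⟩
  obtain ⟨φ, hφ, hmap⟩ := exists_orderIso_map_eq_volume μ
  have hφN : ∀ x, dist (φ x) x < min δ (ε / 8) := fun x => by
    rw [Subtype.dist_eq, Real.dist_eq, hφ]
    exact (hclose x).trans_lt (by exact_mod_cast hN)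
  let Φ : unitI ≃ₜ unitI := φ.toHomeomorph
  set g : C(unitI, unitI) := ((Φ : C(unitI, unitI)).comp h).comp (Φ.symm : C(unitI, unitI)) with hg
  have hconj : Semiconj Φ h g := fun x => by simp [hg]
  have hvol : ∀ s : Set unitI, volume ((↑) '' s : Set ℝ) = μ (Φ ⁻¹' s) := fun s => by
    rw [← unitInterval.volume_apply, ← hmap]
    exact Φ.measurableEmbedding.map_apply μ s
  have hgleo : Leo g := hleo.of_semiconj hconj
  refine ⟨g, hgleo.mem_CP, ?_, hgleo, ?_, fun k hk => ?_⟩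
  · have hhg : dist h g ≤ ε / 4 := by
      rw [ContinuousMap.dist_le (by positivity)]
      intro y
      obtain ⟨x, rfl⟩ := Φ.surjective y
      rw [← hconj x, dist_comm]
      have h1 : dist (Φ (h x)) (h x) < ε / 8 := (hφN (h x)).trans_le (min_le_right _ _)
      have h2 : dist (h x) (h (Φ x)) < ε / 8 :=
        hhδ ((dist_comm x (φ x)).trans_lt ((hφN x).trans_le (min_le_left _ _)))
      exact (dist_triangle _ (h x) _).trans (by linarith)
    linarith [dist_triangle f h g]
  · have hpre : Φ ⁻¹' PerAll g = PerAll h := by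
      simp only [PerAll, preimage_iUnion, PerSet_eq_preimage_of_semiconj hconj]
    rw [hvol, hpre]
    exact (prob_compl_eq_zero_iff₀ (NullMeasurableSet.of_compl
      (NullMeasurableSet.of_null (hμ hper)))).mp (hμ hper)
  · rw [hvol, ← PerSet_eq_preimage_of_semiconj hconj]
    exact pos_iff_ne_zero.mpr fun h0 => hpos k hk (hμ' h0)
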